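/- Let (g,A) be a cell with rotundity ρ(g) > 0, K a compact subset of g containing A, and φ a function analytic on ℂ∖K with φ(∞)=0 that extends continuously to both sides of K near A with limsup_{z→A, z∉K}|φ(z)| well-defined. Then every h ∈ H^∞(g) satisfies ‖φ−h‖_{∞, g∖K} ≥ (ρ(g)/2)·limsup_{z→A}|φ(z)|. -/

import Mathlib

open MeasureTheory Metric Real


namespace Cell

/-- The Wirtinger derivative. -/
noncomputable def dbar (f : ℂ → ℂ) (z : ℂ) : ℂ :=
  (fderiv ℝ f z 1 + Complex.I * fderiv ℝ f z Complex.I) / 2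

/-- Test functions supported in a set. -/
def Test (U : Set ℂ) (χ : ℂ → ℂ) : Prop :=
  ContDiff ℝ 1 χ ∧ HasCompactSupport χ ∧ tsupport χ ⊆ U

lemma Test.mono {U V : Set ℂ} {χ : ℂ → ℂ} (h : Test U χ) (hUV : U ⊆ V) : Test V χ :=
  ⟨h.1, h.2.1, h.2.2.trans hUV⟩

lemma dbar_mul {f g : ℂ → ℂ} {z : ℂ} (hf : DifferentiableAt ℝ f z) (hg : DifferentiableAt ℝ g z) :
    dbar (fun w => f w * g w) z = f z * dbar g z + g z * dbar f z := by
  unfold dbar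
  rw [fderiv_fun_mul hf hg]
  simp
  ring

lemma dbar_add {f g : ℂ → ℂ} {z : ℂ} (hf : DifferentiableAt ℝ f z) (hg : DifferentiableAt ℝ g z) :
    dbar (fun w => f w + g w) z = dbar f z + dbar g z := by
  unfold dbar
  rw [fderiv_fun_add hf hg]
  simp
  ring

lemma dbar_const_mul {f : ℂ → ℂ} {z : ℂ} (c : ℂ) (hf : DifferentiableAt ℝ f z) :
    dbar (fun w => c * f w) z = c * dbar f z := by
  rw [dbar_mul (differentiableAt_const c) hf]
  simp [dbar]

lemma dbar_holo {f : ℂ → ℂ} {z : ℂ} (hf : DifferentiableAt ℂ f z) : dbar f z = 0 := by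
  unfold dbar
  rw [hf.fderiv_restrictScalars ℝ]
  have : (fderiv ℂ f z) Complex.I = Complex.I * (fderiv ℂ f z) 1 := by
    rw [← smul_eq_mul, ← map_smul]; simp
  simp only [ContinuousLinearMap.coe_restrictScalars', this]
  rw [← mul_assoc, Complex.I_mul_I]; ring

lemma dbar_congr {f g : ℂ → ℂ} {z : ℂ} (h : f =ᶠ[nhds z] g) : dbar f z = dbar g z := by
  unfold dbar; rw [h.fderiv_eq]

lemma dbar_zero_of {f : ℂ → ℂ} {z : ℂ} (h : z ∉ tsupport f) : dbar f z = 0 := by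
  rw [dbar_congr (notMem_tsupport_iff_eventuallyEq.1 h)]
  simp [dbar]

lemma norm_dbar_le (f : ℂ → ℂ) (z : ℂ) : ‖dbar f z‖ ≤ ‖fderiv ℝ f z‖ := by
  unfold dbar
  rw [norm_div]
  have h1 : ‖fderiv ℝ f z 1‖ ≤ ‖fderiv ℝ f z‖ := by
    simpa using (fderiv ℝ f z).le_opNorm 1
  have h2 : ‖Complex.I * fderiv ℝ f z Complex.I‖ ≤ ‖fderiv ℝ f z‖ := by
    simpa using (fderiv ℝ f z).le_opNorm Complex.I
  have := norm_add_le (fderiv ℝ f z 1) (Complex.I * fderiv ℝ f z Complex.I)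
  simp only [Complex.norm_ofNat]
  linarith

lemma continuous_dbar {f : ℂ → ℂ} (hf : ContDiff ℝ 1 f) : Continuous (dbar f) := by
  unfold dbar
  have := hf.continuous_fderiv one_ne_zero
  fun_prop

lemma compact_dbar {f : ℂ → ℂ} (hf : HasCompactSupport f) : HasCompactSupport (dbar f) := by
  refine HasCompactSupport.intro hf ?_
  intro x hx
  exact dbar_zero_of hx

lemma integrable_dbar {f : ℂ → ℂ} (hf : ContDiff ℝ 1 f) (hc : HasCompactSupport f) :
    Integrable (dbar f) :=
  (continuous_dbar hf).integrable_of_hasCompactSupport (compact_dbar hc)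

lemma integral_fderiv_zero {f : ℂ → ℂ} (hf : ContDiff ℝ 1 f) (hc : HasCompactSupport f) (v : ℂ) :
    ∫ z, fderiv ℝ f z v = 0 := by
  have hd := hf.continuous_fderiv one_ne_zero
  have := integral_mul_fderiv_eq_neg_fderiv_mul_of_integrable (μ := (volume : Measure ℂ))
    (f := fun _ => (1:ℂ)) (g := f) (v := v) (by simp)
    (by
      simp only [one_mul]
      refine Continuous.integrable_of_hasCompactSupport (by fun_prop) ?_
      exact hc.fderiv_apply (𝕜 := ℝ) v)
    (by
      simp only [one_mul]
      exact hf.continuous.integrable_of_hasCompactSupport hc)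
    (by intros; fun_prop)
    (fun x _ => (hf.differentiable one_ne_zero) x)
  simpa using this

lemma integral_dbar_zero {f : ℂ → ℂ} (hf : ContDiff ℝ 1 f) (hc : HasCompactSupport f) :
    ∫ z, dbar f z = 0 := by
  have hd := hf.continuous_fderiv one_ne_zero
  have hi : ∀ v, Integrable (fun z => fderiv ℝ f z v) := fun v =>
    Continuous.integrable_of_hasCompactSupport (by fun_prop) (hc.fderiv_apply (𝕜 := ℝ) v)
  unfold dbar
  rw [integral_div, integral_add (hi 1) ((hi _).const_mul _), integral_const_mul,
    integral_fderiv_zero hf hc, integral_fderiv_zero hf hc]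
  simp

lemma test_mul_holo {V : Set ℂ} (hV : IsOpen V) {u χ : ℂ → ℂ} (hu : DifferentiableOn ℂ u V)
    (hχ : Test V χ) : ContDiff ℝ 1 (fun z => u z * χ z) := by
  rw [contDiff_iff_contDiffAt]
  intro z
  by_cases hz : z ∈ tsupport χ
  · have h1 : ContDiffAt ℂ 1 u z := (hu.contDiffOn hV).contDiffAt (hV.mem_nhds (hχ.2.2 hz))
    exact (h1.restrict_scalars ℝ).mul hχ.1.contDiffAt
  · have : (fun w => u w * χ w) =ᶠ[nhds z] fun _ => 0 := by
      filter_upwards [notMem_tsupport_iff_eventuallyEq.1 hz] with w hw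
      simp [hw]
    exact contDiffAt_const.congr_of_eventuallyEq this

lemma integral_holo_dbar {V : Set ℂ} (hV : IsOpen V) {u χ : ℂ → ℂ} (hu : DifferentiableOn ℂ u V)
    (hχ : Test V χ) : ∫ z, u z * dbar χ z = 0 := by
  have h1 := test_mul_holo hV hu hχ
  have h2 : HasCompactSupport (fun z => u z * χ z) := hχ.2.1.mul_left
  rw [← integral_dbar_zero h1 h2]
  congr 1
  ext z
  by_cases hz : z ∈ tsupport χ
  · have hd : DifferentiableAt ℂ u z := hu.differentiableAt (hV.mem_nhds (hχ.2.2 hz))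
    rw [dbar_mul (hd.restrictScalars ℝ) ((hχ.1.differentiable one_ne_zero) z), dbar_holo hd]
    simp
  · rw [dbar_zero_of hz, dbar_zero_of]
    · simp
    · intro h
      exact hz (closure_mono (Function.support_mul_subset_right _ _) h)

/-- Universal cutoffs. -/
lemma exists_cutoff : ∃ C : ℝ, 0 < C ∧ ∀ (x : ℂ) (r : ℝ), 0 < r → ∃ θ : ℂ → ℂ,
    ContDiff ℝ 1 θ ∧ (∀ z ∈ closedBall x r, θ z = 1) ∧ tsupport θ ⊆ closedBall x (2 * r) ∧
    (∀ z, ‖θ z‖ ≤ 1) ∧ (∀ z, ‖1 - θ z‖ ≤ 1) ∧ (∀ z, ‖fderiv ℝ θ z‖ ≤ C / r) := by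
  let f : ContDiffBump (0 : ℂ) := ⟨1, 2, one_pos, one_lt_two⟩
  let θ0 : ℂ → ℂ := fun z => ((f z : ℝ) : ℂ)
  have h0 : ContDiff ℝ 1 θ0 := Complex.ofRealCLM.contDiff.comp (f.contDiff (n := 1))
  have hc0 : HasCompactSupport θ0 := f.hasCompactSupport.comp_left (g := fun x : ℝ => (x:ℂ)) (by simp)
  obtain ⟨C, hC⟩ := (h0.continuous_fderiv one_ne_zero).bounded_above_of_compact_support
    (hc0.fderiv (𝕜 := ℝ))
  refine ⟨|C| + 1, by positivity, fun x r hr => ?_⟩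
  have hlin : ∀ z, HasFDerivAt (fun z : ℂ => r⁻¹ • (z - x))
      (r⁻¹ • ContinuousLinearMap.id ℝ ℂ) z := fun z =>
    ((hasFDerivAt_id z).sub_const x).const_smul r⁻¹
  refine ⟨fun z => θ0 (r⁻¹ • (z - x)), ?_, ?_, ?_, ?_, ?_, ?_⟩
  · exact h0.comp (by fun_prop)
  · intro z hz
    have : f (r⁻¹ • (z - x)) = 1 := by
      apply f.one_of_mem_closedBall
      rw [mem_closedBall, dist_eq_norm] at hz
      simp only [mem_closedBall, dist_zero_right, norm_smul, norm_inv, Real.norm_eq_abs,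
        abs_of_pos hr]
      change r⁻¹ * ‖z - x‖ ≤ 1
      rw [inv_mul_le_iff₀ hr]; simpa using hz
    simp only [θ0, this]; simp
  · apply closure_minimal _ isClosed_closedBall
    intro z hz
    by_contra hcon
    apply hz
    have : f (r⁻¹ • (z - x)) = 0 := by
      apply f.zero_of_le_dist
      rw [mem_closedBall, dist_eq_norm, not_le] at hcon
      simp only [dist_zero_right, norm_smul, norm_inv, Real.norm_eq_abs, abs_of_pos hr]
      change 2 ≤ r⁻¹ * ‖z - x‖
      rw [le_inv_mul_iff₀ hr]; linarith
    simp only [θ0, this]; simp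
  · intro z
    have h1 := f.nonneg' (r⁻¹ • (z - x))
    have h2 := f.le_one (x := r⁻¹ • (z - x))
    simp only [θ0, Complex.norm_real, Real.norm_eq_abs]
    rw [abs_le]; constructor <;> linarith
  · intro z
    have h1 := f.nonneg' (r⁻¹ • (z - x))
    have h2 := f.le_one (x := r⁻¹ • (z - x))
    simp only [θ0]
    rw [← Complex.ofReal_one, ← Complex.ofReal_sub]
    simp only [Complex.norm_real, Real.norm_eq_abs]
    rw [abs_le]; constructor <;> linarith
  · intro z
    have h := ((h0.differentiable one_ne_zero) (r⁻¹ • (z - x))).hasFDerivAt.comp z (hlin z)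
    have h' : fderiv ℝ (fun z => θ0 (r⁻¹ • (z - x))) z = _ := h.fderiv
    rw [h']
    have : (fderiv ℝ θ0 (r⁻¹ • (z - x))).comp (r⁻¹ • ContinuousLinearMap.id ℝ ℂ)
      = r⁻¹ • fderiv ℝ θ0 (r⁻¹ • (z - x)) := by
      ext; simp
    rw [this, norm_smul, norm_inv, Real.norm_eq_abs, abs_of_pos hr, div_eq_inv_mul]
    gcongr
    exact (hC _).trans ((le_abs_self C).trans (by linarith))

end Cell


namespace Cell
open scoped ENNReal

lemma exists_cover_sets (S : Set ℂ) (hS : μH[1] S ≠ ∞) {δ : ℝ≥0∞} (hδ : 0 < δ) {a : ℝ≥0∞} (ha : 0 < a) :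
    ∃ t : ℕ → Set ℂ, S ⊆ ⋃ n, t n ∧ (∀ n, ediam (t n) ≤ δ) ∧
      ∑' n, ediam (t n) ≤ μH[1] S + a := by
  have h := Measure.hausdorffMeasure_apply (X := ℂ) 1 S
  have hlt : (⨅ (t : ℕ → Set ℂ), ⨅ (_ : S ⊆ ⋃ n, t n), ⨅ (_ : ∀ (n : ℕ), ediam (t n) ≤ δ),
      ∑' (n : ℕ), ⨆ (_ : (t n).Nonempty), ediam (t n) ^ (1:ℝ)) < μH[1] S + a := by
    refine lt_of_le_of_lt ?_ (ENNReal.lt_add_right hS ha.ne')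
    rw [h]
    exact le_iSup₂_of_le δ hδ le_rfl
  simp only [iInf_lt_iff] at hlt
  obtain ⟨t, h1, h2, h3⟩ := hlt
  refine ⟨t, h1, h2, le_trans (ENNReal.tsum_le_tsum fun n => ?_) h3.le⟩
  rcases (t n).eq_empty_or_nonempty with h | h
  · simp [h]
  · simp [h]

lemma exists_cover_balls (S : Set ℂ) (hS : μH[1] S ≠ ∞) {δ : ℝ} (hδ : 0 < δ) {a : ℝ≥0∞} (ha : 0 < a) :
    ∃ (I : Set ℕ) (x : ℕ → ℂ) (r : ℕ → ℝ), (∀ n, 0 < r n ∧ r n ≤ δ) ∧ (∀ n ∈ I, x n ∈ S) ∧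
      S ⊆ ⋃ n ∈ I, ball (x n) (r n) ∧ ∑' n, ENNReal.ofReal (r n) ≤ μH[1] S + a := by
  obtain ⟨t, h1, h2, h3⟩ := exists_cover_sets S hS (δ := ENNReal.ofReal (δ/2)) (by simpa using hδ)
    (a := a / 2) (by simpa using ha.ne')
  obtain ⟨e, he0, he⟩ := ENNReal.exists_pos_sum_of_countable' (ε := a/2) (by simpa using ha.ne') ℕ
  have hfin : ∀ n, ediam (t n) ≠ ∞ := fun n => ((h2 n).trans_lt ENNReal.ofReal_lt_top).ne
  have hd : ∀ n, diam (t n) ≤ δ / 2 := fun n =>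
    ENNReal.toReal_le_of_le_ofReal (by positivity) (h2 n)
  choose! y hy using fun (n : ℕ) (h : (t n ∩ S).Nonempty) => h
  have hmin : ∀ n, min (e n) (ENNReal.ofReal (δ/2)) ≠ ∞ := fun n =>
    (min_le_right _ _ |>.trans_lt ENNReal.ofReal_lt_top).ne
  have hminpos : ∀ n, 0 < min (e n) (ENNReal.ofReal (δ/2)) := fun n =>
    lt_min (he0 n) (by simpa using hδ)
  refine ⟨{n | (t n ∩ S).Nonempty}, y, fun n => diam (t n) +
    (min (e n) (ENNReal.ofReal (δ/2))).toReal, ?_, fun n hn => (hy n hn).2, ?_, ?_⟩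
  · intro n
    have hp : 0 < (min (e n) (ENNReal.ofReal (δ/2))).toReal :=
      ENNReal.toReal_pos (hminpos n).ne' (hmin n)
    have hq : (min (e n) (ENNReal.ofReal (δ/2))).toReal ≤ δ / 2 :=
      ENNReal.toReal_le_of_le_ofReal (by positivity) (min_le_right _ _)
    have := diam_nonneg (s := t n)
    have := hd n
    constructor <;> linarith
  · intro z hz
    obtain ⟨n, hn⟩ := Set.mem_iUnion.1 (h1 hz)
    have hne : (t n ∩ S).Nonempty := ⟨z, hn, hz⟩
    simp only [Set.mem_iUnion]
    refine ⟨n, hne, ?_⟩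
    have hb : Bornology.IsBounded (t n) := isBounded_iff_ediam_ne_top.2 (hfin n)
    have := dist_le_diam_of_mem hb hn (hy n hne).1
    have hp : 0 < (min (e n) (ENNReal.ofReal (δ/2))).toReal :=
      ENNReal.toReal_pos (hminpos n).ne' (hmin n)
    rw [mem_ball]
    linarith
  · calc ∑' n, ENNReal.ofReal (diam (t n) + (min (e n) (ENNReal.ofReal (δ/2))).toReal)
        ≤ ∑' n, (ediam (t n) + e n) := by
          refine ENNReal.tsum_le_tsum fun n => ?_
          rw [ENNReal.ofReal_add diam_nonneg ENNReal.toReal_nonneg, ENNReal.ofReal_toReal (hmin n)]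
          gcongr
          · rw [diam, ENNReal.ofReal_toReal (hfin n)]
          · exact min_le_left _ _
      _ ≤ (μH[1] S + a/2) + a/2 := by
          rw [ENNReal.tsum_add]
          gcongr
      _ = μH[1] S + a := by rw [add_assoc, ENNReal.add_halves]

/-- Weighted covering. -/
lemma exists_weighted_cover (E : Set ℂ) (hE : IsCompact E) (hfin : μH[1] E ≠ ∞) (f : ℂ → ℝ)
    (hf : UniformContinuous f) (hf0 : ∀ z, 0 ≤ f z) {ε : ℝ} (hε : 0 < ε) :
    ∃ (s : Finset (ℕ × ℕ)) (x : ℕ × ℕ → ℂ) (r : ℕ × ℕ → ℝ) (m : ℕ × ℕ → ℝ),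
      (∀ i, 0 < r i ∧ r i ≤ ε) ∧ E ⊆ ⋃ i ∈ s, ball (x i) (r i) ∧
      (∀ i, 0 ≤ m i) ∧ (∀ i ∈ s, ∀ z ∈ closedBall (x i) (2 * r i), f z ≤ m i) ∧
      ∑ i ∈ s, ENNReal.ofReal (r i) ≤ μH[1] E + ENNReal.ofReal ε ∧
      ∑ i ∈ s, ENNReal.ofReal (r i * m i) ≤ ∫⁻ z in E, ENNReal.ofReal (f z) ∂μH[1] +
        ENNReal.ofReal (2 * ε) * μH[1] E + ENNReal.ofReal ε := by
  obtain ⟨δ, hδ, hfδ⟩ := Metric.uniformContinuous_iff.1 hf ε hε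
  let A : ℕ → Set ℂ := fun k => E ∩ {z | ⌊f z / ε⌋₊ = k}
  have hAmeas : ∀ k, MeasurableSet (A k) := fun k =>
    hE.measurableSet.inter ((Nat.measurable_floor.comp
      (hf.continuous.measurable.div_const ε)) (measurableSet_singleton k))
  have hAE : ⋃ k, A k = E := by
    ext z; simp [A]
  have hAdisj : Pairwise (Function.onFun Disjoint A) := by
    intro i j hij
    refine Set.disjoint_left.2 fun z hz hz' => hij ?_
    rw [← hz.2, ← hz'.2]
  obtain ⟨e, he0, he⟩ := ENNReal.exists_pos_sum_of_countable' (ε := ENNReal.ofReal ε)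
    (by simpa using hε) ℕ
  have hAfin : ∀ k, μH[1] (A k) ≠ ∞ := fun k =>
    (measure_mono Set.inter_subset_left |>.trans_lt hfin.lt_top).ne
  let w : ℕ → ℝ≥0∞ := fun k => 1 + ENNReal.ofReal ((k + 2) * ε)
  have hw : ∀ k, w k ≠ ∞ := fun k => by simp [w]
  have hw0 : ∀ k, w k ≠ 0 := fun k => by simp [w]
  have hcov := fun k => exists_cover_balls (A k) (hAfin k) (δ := min ε (δ/3)) (by positivity)
    (a := e k / w k) (ENNReal.div_pos (he0 k).ne' (hw k))
  choose I x r hr hx hsub hsum using hcov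
  have hcov2 : E ⊆ ⋃ i : {p : ℕ × ℕ // p.2 ∈ I p.1}, ball (x i.1.1 i.1.2) (r i.1.1 i.1.2) := by
    intro z hz
    rw [← hAE] at hz
    obtain ⟨k, hk⟩ := Set.mem_iUnion.1 hz
    have := hsub k hk
    simp only [Set.mem_iUnion] at this
    obtain ⟨n, hn, hzn⟩ := this
    exact Set.mem_iUnion.2 ⟨⟨(k, n), hn⟩, hzn⟩
  obtain ⟨s, hs⟩ := hE.elim_finite_subcover _ (fun i => isOpen_ball) hcov2
  have htot : ∀ (c : ℕ → ℝ≥0∞) (hc : ∀ k, c k ≤ w k),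
      ∑' p : ℕ × ℕ, c p.1 * ENNReal.ofReal (r p.1 p.2) ≤ ∑' k, c k * μH[1] (A k) + ENNReal.ofReal ε := by
    intro c hc
    rw [ENNReal.tsum_prod (f := fun k n => c k * ENNReal.ofReal (r k n))]
    refine le_trans ?_ (add_le_add_right he.le _)
    rw [← ENNReal.tsum_add]
    refine ENNReal.tsum_le_tsum fun k => ?_
    rw [ENNReal.tsum_mul_left]
    calc c k * ∑' n, ENNReal.ofReal (r k n) ≤ c k * (μH[1] (A k) + e k / w k) := by
          gcongr; exact hsum k
      _ = c k * μH[1] (A k) + c k * (e k / w k) := mul_add _ _ _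
      _ ≤ c k * μH[1] (A k) + w k * (e k / w k) := by gcongr; exact hc k
      _ = _ := by rw [ENNReal.mul_div_cancel (hw0 k) (hw k)]
  have hAsum : ∑' k, μH[1] (A k) = μH[1] E := by
    rw [← hAE, measure_iUnion hAdisj hAmeas]
  refine ⟨s.map (Function.Embedding.subtype _), fun p => x p.1 p.2, fun p => r p.1 p.2,
    fun p => (p.1 + 2) * ε, ?_, ?_, ?_, ?_, ?_, ?_⟩
  · intro p
    exact ⟨(hr p.1 p.2).1, (hr p.1 p.2).2.trans (min_le_left _ _)⟩
  · intro z hz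
    have := hs hz
    simp only [Set.mem_iUnion] at this ⊢
    obtain ⟨i, hi, hzi⟩ := this
    exact ⟨i.1, by simpa using ⟨i.2, hi⟩, hzi⟩
  · intro p; positivity
  · intro p hp z hz
    simp only [Finset.mem_map, Function.Embedding.subtype_apply] at hp
    obtain ⟨i, _, rfl⟩ := hp
    have hxi := hx i.1.1 i.1.2 i.2
    have h1 : f (x i.1.1 i.1.2) < (i.1.1 + 1) * ε := by
      have := Nat.lt_floor_add_one (f (x i.1.1 i.1.2) / ε)
      rw [hxi.2, div_lt_iff₀ hε] at this
      exact this
    have h2 := hfδ (a := z) (b := x i.1.1 i.1.2) (by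
      have h3 := (hr i.1.1 i.1.2).2.trans (min_le_right _ _)
      rw [mem_closedBall] at hz
      linarith)
    rw [Real.dist_eq] at h2
    have := le_abs_self (f z - f (x i.1.1 i.1.2))
    linarith
  · refine (ENNReal.sum_le_tsum _).trans ?_
    have := htot (fun _ => 1) (fun k => by simp [w])
    simp only [one_mul] at this
    rw [hAsum] at this
    exact this
  · have h1 : ∑ i ∈ s.map (Function.Embedding.subtype _),
        ENNReal.ofReal (r i.1 i.2 * ((i.1 + 2) * ε)) ≤ _ := (ENNReal.sum_le_tsum _)
    refine h1.trans ?_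
    have h2 := htot (fun k => ENNReal.ofReal ((k + 2) * ε)) (fun k => by simp [w])
    have h3 : ∀ p : ℕ × ℕ, ENNReal.ofReal (r p.1 p.2 * ((p.1 + 2) * ε)) =
        ENNReal.ofReal ((p.1 + 2) * ε) * ENNReal.ofReal (r p.1 p.2) := fun p => by
      rw [mul_comm, ENNReal.ofReal_mul (by positivity)]
    simp only [h3]
    refine h2.trans ?_
    gcongr
    have h4 : ∀ k : ℕ, ENNReal.ofReal ((k + 2) * ε) * μH[1] (A k) =
        ENNReal.ofReal (k * ε) * μH[1] (A k) + ENNReal.ofReal (2 * ε) * μH[1] (A k) := fun k => by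
      rw [← add_mul, ← ENNReal.ofReal_add (by positivity) (by positivity)]; congr 2; ring
    simp only [h4]
    rw [ENNReal.tsum_add, ENNReal.tsum_mul_left, hAsum]
    gcongr
    calc ∑' k : ℕ, ENNReal.ofReal (k * ε) * μH[1] (A k)
        = ∑' k : ℕ, ∫⁻ z in A k, ENNReal.ofReal (k * ε) ∂μH[1] := by simp
      _ ≤ ∑' k : ℕ, ∫⁻ z in A k, ENNReal.ofReal (f z) ∂μH[1] := by
          refine ENNReal.tsum_le_tsum fun k => ?_
          refine setLIntegral_mono' (hAmeas k) fun z hz => ?_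
          apply ENNReal.ofReal_le_ofReal
          have := Nat.floor_le (div_nonneg (hf0 z) hε.le)
          rw [hz.2, le_div_iff₀ hε] at this
          exact this
      _ = ∫⁻ z in E, ENNReal.ofReal (f z) ∂μH[1] := by
          rw [← lintegral_iUnion hAmeas hAdisj, hAE]

end Cell


namespace Cell
open scoped ENNReal

lemma prod_cutoff {ι : Type*} [DecidableEq ι] (s : Finset ι) (θ : ι → ℂ → ℂ)
    (h1 : ∀ i, ContDiff ℝ 1 (θ i)) (h2 : ∀ i z, ‖1 - θ i z‖ ≤ 1) :
    ContDiff ℝ 1 (fun z => ∏ i ∈ s, (1 - θ i z)) ∧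
    ∀ z, ‖∏ i ∈ s, (1 - θ i z)‖ ≤ 1 ∧ ‖1 - ∏ i ∈ s, (1 - θ i z)‖ ≤ ∑ i ∈ s, ‖θ i z‖ ∧
      ‖fderiv ℝ (fun z => ∏ i ∈ s, (1 - θ i z)) z‖ ≤ ∑ i ∈ s, ‖fderiv ℝ (θ i) z‖ := by
  induction s using Finset.induction_on with
  | empty => simp [contDiff_const]
  | insert a s ha ih =>
    obtain ⟨ih1, ih2⟩ := ih
    have hc : ContDiff ℝ 1 (fun z => (1 - θ a z)) := contDiff_const.sub (h1 a)
    simp only [Finset.prod_insert ha, Finset.sum_insert ha]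
    refine ⟨hc.mul ih1, fun z => ⟨?_, ?_, ?_⟩⟩
    · rw [norm_mul]
      exact mul_le_one₀ (h2 a z) (norm_nonneg _) (ih2 z).1
    · have : 1 - (1 - θ a z) * ∏ i ∈ s, (1 - θ i z) =
        θ a z * ∏ i ∈ s, (1 - θ i z) + (1 - ∏ i ∈ s, (1 - θ i z)) := by ring
      rw [this]
      refine (norm_add_le _ _).trans (add_le_add ?_ (ih2 z).2.1)
      rw [norm_mul]
      exact mul_le_of_le_one_right (norm_nonneg _) (ih2 z).1
    · rw [fderiv_fun_mul ((hc.differentiable one_ne_zero) z) ((ih1.differentiable one_ne_zero) z)]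
      have h3 : fderiv ℝ (fun z => (1 - θ a z)) z = - fderiv ℝ (θ a) z := by
        rw [fderiv_const_sub]
      rw [h3, add_comm]
      refine (norm_add_le _ _).trans (add_le_add ?_ ?_)
      · rw [norm_smul, norm_neg]
        exact mul_le_of_le_one_left (norm_nonneg _) (ih2 z).1
      · rw [norm_smul]
        exact (mul_le_of_le_one_left (norm_nonneg _) (h2 a z)).trans (ih2 z).2.2

lemma lintegral_le_of_support {f : ℂ → ℝ≥0∞} {x : ℂ} {s : ℝ} {c : ℝ} (hs : 0 ≤ s) (hc : 0 ≤ c)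
    (h1 : ∀ z ∉ closedBall x s, f z = 0) (h2 : ∀ z ∈ closedBall x s, f z ≤ ENNReal.ofReal c) :
    ∫⁻ z, f z ≤ ENNReal.ofReal (c * (π * s ^ 2)) := by
  have : ∫⁻ z, f z ≤ ∫⁻ z in closedBall x s, ENNReal.ofReal c := by
    rw [← lintegral_indicator isClosed_closedBall.measurableSet]
    refine lintegral_mono fun z => ?_
    by_cases hz : z ∈ closedBall x s
    · simp [hz]; exact h2 z (by simpa using hz)
    · rw [h1 z hz]; exact zero_le
  refine this.trans ?_
  rw [lintegral_const, Measure.restrict_apply_univ, Complex.volume_closedBall,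
    ENNReal.ofReal_mul hc, mul_comm π, ENNReal.ofReal_mul (by positivity), ENNReal.ofReal_pow hs]
  gcongr
  apply le_of_eq
  rw [ENNReal.ofReal, NNReal.coe_inj.1 (show ((Real.toNNReal π : NNReal) : ℝ) = NNReal.pi by
    simp [Real.pi_pos.le])]

/-- Step 1: linear bound with a universal constant. -/
lemma linear_bound : ∃ C0 : ℝ, 0 < C0 ∧ ∀ (E U : Set ℂ) (u : ℂ → ℂ) (M : ℝ) (χ : ℂ → ℂ),
    IsCompact E → μH[1] E ≠ ∞ → IsOpen U → Measurable u → (∀ z, ‖u z‖ ≤ M) →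
    DifferentiableOn ℂ u (U \ E) → Test U χ →
    ENNReal.ofReal ‖∫ z, u z * dbar χ z‖ ≤
      ENNReal.ofReal (C0 * M) * ∫⁻ z in E, ENNReal.ofReal ‖χ z‖ ∂μH[1] := by
  obtain ⟨C, hC, hcut⟩ := exists_cutoff
  refine ⟨4 * π * C, by positivity, ?_⟩
  intro E U u M χ hE hfin hU hum huM hud hχ
  have hM : 0 ≤ M := (norm_nonneg _).trans (huM 0)
  obtain ⟨D0, hD0⟩ := (continuous_dbar hχ.1).bounded_above_of_compact_support (compact_dbar hχ.2.1)
  obtain ⟨D, hDpos, hD⟩ : ∃ D : ℝ, 0 ≤ D ∧ ∀ z, ‖dbar χ z‖ ≤ D :=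
    ⟨|D0|, abs_nonneg _, fun z => (hD0 z).trans (le_abs_self _)⟩
  have huc : UniformContinuous (fun z => ‖χ z‖) :=
    uniformContinuous_norm.comp (hχ.1.continuous.uniformContinuous_of_tendsto_cocompact hχ.2.1.is_zero_at_infty)
  have key : ∀ ε : ℝ, 0 < ε → ENNReal.ofReal ‖∫ z, u z * dbar χ z‖ ≤
      ENNReal.ofReal (4 * π * M * D * ε) * (μH[1] E + ENNReal.ofReal ε) +
      ENNReal.ofReal (4 * π * C * M) * (∫⁻ z in E, ENNReal.ofReal ‖χ z‖ ∂μH[1] +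
        ENNReal.ofReal (2 * ε) * μH[1] E + ENNReal.ofReal ε) := by
    intro ε hε
    obtain ⟨s, x, r, m, hr, hcov, hm0, hm, hsum1, hsum2⟩ :=
      exists_weighted_cover E hE hfin (fun z => ‖χ z‖) huc (fun z => norm_nonneg _) hε
    choose θ hθ1 hθ2 hθ3 hθ4 hθ5 hθ6 using fun i => hcut (x i) (r i) (hr i).1
    obtain ⟨hP1, hP2⟩ := prod_cutoff s θ hθ1 hθ5
    set P : ℂ → ℂ := fun z => ∏ i ∈ s, (1 - θ i z) with hP
    have hPd : Differentiable ℝ P := hP1.differentiable one_ne_zero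
    have hχd : Differentiable ℝ χ := hχ.1.differentiable one_ne_zero
    have ht : Test (U \ E) (fun z => χ z * P z) := by
      refine ⟨hχ.1.mul hP1, hχ.2.1.mul_right, fun z hz => ⟨?_, fun hzE => ?_⟩⟩
      · exact hχ.2.2 (closure_mono (Function.support_mul_subset_left _ _) hz)
      · have := hcov hzE
        simp only [Set.mem_iUnion] at this
        obtain ⟨i, hi, hzi⟩ := this
        refine (notMem_tsupport_iff_eventuallyEq.2 ?_) hz
        filter_upwards [isOpen_ball.mem_nhds hzi] with w hw
        have : P w = 0 := Finset.prod_eq_zero hi (by rw [hθ2 i w (ball_subset_closedBall hw)]; simp)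
        simp [this]
    have hzero := integral_holo_dbar (hU.sdiff hE.isClosed) hud ht
    have hpt : ∀ z, u z * dbar χ z = u z * dbar (fun z => χ z * P z) z +
        u z * ((1 - P z) * dbar χ z - χ z * dbar P z) := by
      intro z
      rw [dbar_mul (hχd z) (hPd z)]; ring
    have hi1 : Integrable (fun z => u z * dbar (fun z => χ z * P z) z) :=
      (integrable_dbar ht.1 ht.2.1).bdd_mul hum.aestronglyMeasurable
        (Filter.Eventually.of_forall huM)
    have hi2 : Integrable (fun z => u z * ((1 - P z) * dbar χ z - χ z * dbar P z)) := by
      refine Integrable.bdd_mul ?_ hum.aestronglyMeasurable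
        (Filter.Eventually.of_forall huM)
      have c1 := continuous_dbar hχ.1
      have c2 := continuous_dbar hP1
      have c3 := hχ.1.continuous
      have c4 := hP1.continuous
      refine Continuous.integrable_of_hasCompactSupport (by fun_prop) ?_
      exact ((compact_dbar hχ.2.1).mul_left).sub (hχ.2.1.mul_right)
    have heq : ∫ z, u z * dbar χ z = ∫ z, u z * ((1 - P z) * dbar χ z - χ z * dbar P z) := by
      rw [integral_congr_ae (Filter.Eventually.of_forall hpt), integral_add hi1 hi2, hzero, zero_add]
    rw [heq]
    have hbd : ∀ z, ENNReal.ofReal ‖u z * ((1 - P z) * dbar χ z - χ z * dbar P z)‖ ≤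
        ∑ i ∈ s, (ENNReal.ofReal (M * D * ‖θ i z‖) +
          ENNReal.ofReal (M * (‖χ z‖ * ‖fderiv ℝ (θ i) z‖))) := by
      intro z
      rw [Finset.sum_congr rfl (fun i _ => (ENNReal.ofReal_add (by positivity) (by positivity)).symm),
        ← ENNReal.ofReal_sum_of_nonneg (fun i _ => by positivity)]
      apply ENNReal.ofReal_le_ofReal
      rw [Finset.sum_add_distrib, ← Finset.mul_sum, ← Finset.mul_sum, ← Finset.mul_sum, norm_mul]
      calc ‖u z‖ * ‖(1 - P z) * dbar χ z - χ z * dbar P z‖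
          ≤ M * ((∑ i ∈ s, ‖θ i z‖) * D + ‖χ z‖ * ∑ i ∈ s, ‖fderiv ℝ (θ i) z‖) := by
            refine mul_le_mul (huM z) ?_ (norm_nonneg _) hM
            refine (norm_sub_le _ _).trans (add_le_add ?_ ?_)
            · rw [norm_mul]
              exact mul_le_mul (hP2 z).2.1 (hD z) (norm_nonneg _) (Finset.sum_nonneg fun i _ => norm_nonneg _)
            · rw [norm_mul]
              exact mul_le_mul_of_nonneg_left ((norm_dbar_le _ _).trans (hP2 z).2.2) (norm_nonneg _)
        _ = _ := by ring
    calc ENNReal.ofReal ‖∫ z, u z * ((1 - P z) * dbar χ z - χ z * dbar P z)‖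
        ≤ ∫⁻ z, ENNReal.ofReal ‖u z * ((1 - P z) * dbar χ z - χ z * dbar P z)‖ := by
          rw [ofReal_norm]
          simp_rw [ofReal_norm]
          exact enorm_integral_le_lintegral_enorm _
      _ ≤ ∫⁻ z, ∑ i ∈ s, (ENNReal.ofReal (M * D * ‖θ i z‖) +
          ENNReal.ofReal (M * (‖χ z‖ * ‖fderiv ℝ (θ i) z‖))) := lintegral_mono hbd
      _ = ∑ i ∈ s, ((∫⁻ z, ENNReal.ofReal (M * D * ‖θ i z‖)) +
          ∫⁻ z, ENNReal.ofReal (M * (‖χ z‖ * ‖fderiv ℝ (θ i) z‖))) := by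
          have m1 : ∀ i, Measurable (fun z => ENNReal.ofReal (M * D * ‖θ i z‖)) := fun i => by
            have := (hθ1 i).continuous
            exact (ENNReal.continuous_ofReal.comp (by fun_prop)).measurable
          have m2 : ∀ i, Measurable (fun z => ENNReal.ofReal (M * (‖χ z‖ * ‖fderiv ℝ (θ i) z‖))) := fun i => by
            have := (hθ1 i).continuous_fderiv one_ne_zero
            have c3 := hχ.1.continuous
            exact (ENNReal.continuous_ofReal.comp (by fun_prop)).measurable
          have m3 : ∀ i ∈ s, Measurable (fun z => ENNReal.ofReal (M * D * ‖θ i z‖) +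
            ENNReal.ofReal (M * (‖χ z‖ * ‖fderiv ℝ (θ i) z‖))) := fun i _ => (m1 i).add (m2 i)
          rw [lintegral_finsetSum s m3]
          refine Finset.sum_congr rfl fun i _ => ?_
          rw [lintegral_add_left (m1 i)]
      _ ≤ ∑ i ∈ s, (ENNReal.ofReal (4 * π * M * D * ε) * ENNReal.ofReal (r i) +
          ENNReal.ofReal (4 * π * C * M) * ENNReal.ofReal (r i * m i)) := by
          refine Finset.sum_le_sum fun i hi => add_le_add ?_ ?_
          · refine (lintegral_le_of_support (x := x i) (s := 2 * r i) (c := M * D)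
              (by linarith [(hr i).1]) (by positivity) ?_ ?_).trans ?_
            · intro z hz
              rw [image_eq_zero_of_notMem_tsupport (fun h => hz (hθ3 i h))]; simp
            · intro z hz
              apply ENNReal.ofReal_le_ofReal
              exact mul_le_of_le_one_right (by positivity) (hθ4 i z)
            · rw [← ENNReal.ofReal_mul (by positivity)]
              apply ENNReal.ofReal_le_ofReal
              have h1 := (hr i).1
              have h2 := (hr i).2
              have : r i * r i ≤ ε * r i := by gcongr
              have h3 : 0 ≤ 4 * π * M * D := by positivity
              nlinarith [mul_le_mul_of_nonneg_left this h3]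
          · have h1 := (hr i).1
            have := hm0 i
            refine (lintegral_le_of_support (x := x i) (s := 2 * r i) (c := M * (m i * (C / r i)))
              (by linarith [(hr i).1]) (by positivity) ?_ ?_).trans ?_
            · intro z hz
              have : z ∉ tsupport (fderiv ℝ (θ i)) := fun h => hz (hθ3 i (tsupport_fderiv_subset ℝ h))
              rw [image_eq_zero_of_notMem_tsupport this]; simp
            · intro z hz
              apply ENNReal.ofReal_le_ofReal
              exact mul_le_mul_of_nonneg_left (mul_le_mul (hm i hi z hz) (hθ6 i z) (norm_nonneg _) (hm0 i)) hM
            · rw [← ENNReal.ofReal_mul (by positivity)]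
              apply ENNReal.ofReal_le_ofReal
              apply le_of_eq
              field_simp; ring
      _ ≤ _ := by
          rw [Finset.sum_add_distrib, ← Finset.mul_sum, ← Finset.mul_sum]
          gcongr
  have hlim : Filter.Tendsto (fun ε : ℝ => ENNReal.ofReal (4 * π * M * D * ε) * (μH[1] E + ENNReal.ofReal ε) +
      ENNReal.ofReal (4 * π * C * M) * (∫⁻ z in E, ENNReal.ofReal ‖χ z‖ ∂μH[1] +
        ENNReal.ofReal (2 * ε) * μH[1] E + ENNReal.ofReal ε)) (nhdsWithin 0 (Set.Ioi 0))
      (nhds (ENNReal.ofReal (4 * π * M * D * 0) * (μH[1] E + ENNReal.ofReal 0) +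
      ENNReal.ofReal (4 * π * C * M) * (∫⁻ z in E, ENNReal.ofReal ‖χ z‖ ∂μH[1] +
        ENNReal.ofReal (2 * 0) * μH[1] E + ENNReal.ofReal 0))) := by
    have h0 : ∀ c : ℝ, Filter.Tendsto (fun ε : ℝ => ENNReal.ofReal (c * ε)) (nhdsWithin 0 (Set.Ioi 0))
        (nhds (ENNReal.ofReal (c * 0))) := fun c =>
      ((ENNReal.continuous_ofReal.comp (continuous_const.mul continuous_id)).tendsto 0).mono_left
        nhdsWithin_le_nhds
    have h0' : Filter.Tendsto (fun ε : ℝ => ENNReal.ofReal ε) (nhdsWithin 0 (Set.Ioi 0))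
        (nhds (ENNReal.ofReal 0)) := by simpa using h0 1
    refine Filter.Tendsto.add ?_ ?_
    · refine ENNReal.Tendsto.mul (h0 _) (Or.inr ?_) (tendsto_const_nhds.add h0') (Or.inr (by simp))
      simpa using hfin
    · refine ENNReal.Tendsto.const_mul ?_ (Or.inr (by simp))
      refine Filter.Tendsto.add (tendsto_const_nhds.add ?_) h0'
      exact ENNReal.Tendsto.mul_const (h0 2) (Or.inr hfin)
  have := ge_of_tendsto hlim (Filter.eventually_of_mem self_mem_nhdsWithin key)
  simpa using this

end Cell


namespace Cell
open scoped ENNReal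

lemma Test.memLp {U : Set ℂ} {χ : ℂ → ℂ} (h : Test U χ) (μ : Measure ℂ) [IsFiniteMeasure μ] :
    MemLp χ 2 μ := by
  obtain ⟨C, hC⟩ := h.1.continuous.bounded_above_of_compact_support h.2.1
  exact MemLp.of_bound h.1.continuous.aestronglyMeasurable C (Filter.Eventually.of_forall hC)

/-- Submodule of test functions. -/
def testSub (U : Set ℂ) : Submodule ℂ (ℂ → ℂ) where
  carrier := {χ | Test U χ}
  add_mem' := by
    intro a b ha hb
    refine ⟨ha.1.add hb.1, ha.2.1.add hb.2.1, ?_⟩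
    exact (tsupport_add _ _).trans (Set.union_subset ha.2.2 hb.2.2)
  zero_mem' := ⟨contDiff_const, HasCompactSupport.zero, by simp [tsupport]⟩
  smul_mem' := by
    intro c x hx
    exact ⟨contDiff_const.smul hx.1, hx.2.1.smul_left (f := fun _ => c),
      (tsupport_smul_subset_right (fun _ => c) x).trans hx.2.2⟩

lemma exists_rep {H V : Type*} [NormedAddCommGroup H] [InnerProductSpace ℂ H] [CompleteSpace H]
    [AddCommGroup V] [Module ℂ V] (f : V →ₗ[ℂ] H) (Λ : V →ₗ[ℂ] ℂ) (C : ℝ)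
    (hb : ∀ v, ‖Λ v‖ ≤ C * ‖f v‖) : ∃ b : H, ∀ v, Λ v = inner ℂ b (f v) := by
  obtain ⟨s, hs⟩ := f.rangeRestrict.exists_rightInverse_of_surjective f.range_rangeRestrict
  have hs' : ∀ y, f (s y) = y := fun y => by
    have := LinearMap.congr_fun hs y
    exact congrArg Subtype.val this
  let g : (LinearMap.range f) →ₗ[ℂ] ℂ := Λ ∘ₗ s
  have hg : ∀ y, ‖g y‖ ≤ C * ‖y‖ := fun y => by
    have := hb (s y)
    rw [hs'] at this
    exact this
  have hgf : ∀ v, g ⟨f v, LinearMap.mem_range_self f v⟩ = Λ v := fun v => by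
    have h := hb (s ⟨f v, LinearMap.mem_range_self f v⟩ - v)
    rw [map_sub, map_sub, hs', sub_self, norm_zero, mul_zero] at h
    exact sub_eq_zero.1 (norm_le_zero_iff.1 h)
  obtain ⟨G, hG, -⟩ := exists_extension_norm_eq (LinearMap.range f) (g.mkContinuous C hg)
  refine ⟨(InnerProductSpace.toDual ℂ H).symm G, fun v => ?_⟩
  rw [InnerProductSpace.toDual_symm_apply]
  rw [← hgf v]
  exact (hG ⟨f v, LinearMap.mem_range_self f v⟩).symm

lemma integrable_bdd_dbar {u χ : ℂ → ℂ} {M : ℝ} (hum : Measurable u) (huM : ∀ z, ‖u z‖ ≤ M)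
    (h1 : ContDiff ℝ 1 χ) (h2 : HasCompactSupport χ) : Integrable (fun z => u z * dbar χ z) :=
  (integrable_dbar h1 h2).bdd_mul hum.aestronglyMeasurable (Filter.Eventually.of_forall huM)

lemma exists_density {E U : Set ℂ} {u : ℂ → ℂ} {M : ℝ} (hE : IsCompact E) (hfin : μH[1] E ≠ ∞)
    (hU : IsOpen U) (hum : Measurable u) (huM : ∀ z, ‖u z‖ ≤ M)
    (hud : DifferentiableOn ℂ u (U \ E)) :
    ∃ b : ℂ → ℂ, Integrable b ((μH[1]).restrict E) ∧
      ∀ χ, Test U χ → ∫ z, u z * dbar χ z = ∫ z in E, χ z * b z ∂μH[1] := by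
  obtain ⟨C0, hC0, hlin⟩ := linear_bound
  have hM : 0 ≤ M := (norm_nonneg _).trans (huM 0)
  have : Fact (μH[1] E < ∞) := ⟨hfin.lt_top⟩
  set μ : Measure ℂ := (μH[1]).restrict E with hμ
  let f : testSub U →ₗ[ℂ] Lp ℂ 2 μ :=
    { toFun := fun χ => MemLp.toLp χ.1 (Test.memLp χ.2 μ)
      map_add' := fun a b => MemLp.toLp_add _ _
      map_smul' := fun c a => MemLp.toLp_const_smul _ _ }
  let Λ : testSub U →ₗ[ℂ] ℂ :=
    { toFun := fun χ => ∫ z, u z * dbar χ.1 z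
      map_add' := fun a b => by
        have ha : Test U a.1 := a.2
        have hb : Test U b.1 := b.2
        rw [← integral_add (integrable_bdd_dbar hum huM ha.1 ha.2.1) (integrable_bdd_dbar hum huM hb.1 hb.2.1)]
        congr 1; ext z
        have := dbar_add (ha.1.differentiable one_ne_zero z) (hb.1.differentiable one_ne_zero z)
        change u z * dbar (fun w => a.1 w + b.1 w) z = _
        rw [this]; ring
      map_smul' := fun c a => by
        have ha : Test U a.1 := a.2
        change ∫ z, u z * dbar (fun w => c * a.1 w) z = c * _
        rw [← integral_const_mul]
        congr 1; ext z
        rw [dbar_const_mul c (ha.1.differentiable one_ne_zero z)]; ring }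
  obtain ⟨b, hb⟩ := exists_rep f Λ (C0 * M * (μ.real Set.univ) ^ (1/2:ℝ)) (by
    intro χ
    have hχ : Test U χ.1 := χ.2
    have h1 := hlin E U u M χ.1 hE hfin hU hum huM hud hχ
    have h2 : ∫⁻ z in E, ENNReal.ofReal ‖χ.1 z‖ ∂μH[1] = eLpNorm χ.1 1 μ := by
      rw [eLpNorm_one_eq_lintegral_enorm]
      simp only [ofReal_norm]
      rfl
    have h3 : eLpNorm χ.1 1 μ ≤ eLpNorm χ.1 2 μ * μ Set.univ ^ (1/2:ℝ) := by
      have := eLpNorm_le_eLpNorm_mul_rpow_measure_univ (μ := μ) (p := 1) (q := 2) (f := χ.1) (by norm_num)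
        hχ.1.continuous.aestronglyMeasurable
      convert this using 2
      norm_num
    rw [h2] at h1
    have h4 := h1.trans (mul_le_mul_right h3 _)
    have h5 : (μ Set.univ ^ (1/2:ℝ)) ≠ ∞ := by
      apply ENNReal.rpow_ne_top_of_nonneg (by norm_num) (measure_ne_top μ _)
    have h6 := ENNReal.toReal_mono (ENNReal.mul_ne_top ENNReal.ofReal_ne_top
      (ENNReal.mul_ne_top (Test.memLp hχ μ).2.ne h5)) h4
    rw [ENNReal.toReal_ofReal (norm_nonneg _), ENNReal.toReal_mul, ENNReal.toReal_mul,
      ENNReal.toReal_ofReal (by positivity), ← ENNReal.toReal_rpow] at h6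
    have h7 : ‖f χ‖ = (eLpNorm χ.1 2 μ).toReal := Lp.norm_toLp _ (Test.memLp hχ μ)
    rw [h7]
    refine h6.trans (le_of_eq ?_)
    simp only [Measure.real]; ring)
  refine ⟨fun z => (starRingEnd ℂ) (b z), ?_, ?_⟩
  · have : Integrable b μ := (Lp.memLp b).integrable (by norm_num)
    exact (LinearIsometryEquiv.integrable_comp_iff Complex.conjLIE).2 this
  · intro χ hχ
    have := hb ⟨χ, hχ⟩
    change ∫ z, u z * dbar χ z = _ at this
    rw [this, L2.inner_def]
    refine integral_congr_ae ?_
    have h8 : ⇑(f ⟨χ, hχ⟩) =ᵐ[μ] χ := MemLp.coeFn_toLp (Test.memLp hχ μ)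
    filter_upwards [h8] with z hz
    rw [hz]
    simp [mul_comm]

end Cell


namespace Cell
open scoped ENNReal

lemma ae_upper_density {E : Set ℂ} (hE : IsCompact E) (hfin : μH[1] E ≠ ∞) :
    ∀ᵐ x ∂((μH[1]).restrict E), ∃ C : ℝ, 0 < C ∧ ∀ s : ℝ, 0 < s →
      (μH[1]).restrict E (closedBall x s) ≤ ENNReal.ofReal (C * s) := by
  set μ : Measure ℂ := (μH[1]).restrict E with hμ
  have hμu : μ Set.univ = μH[1] E := by simp [hμ]
  set Lr : ℝ := (μH[1] E).toReal with hL
  have hLe : μH[1] E = ENNReal.ofReal Lr := (ENNReal.ofReal_toReal hfin).symm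
  have hL0 : 0 ≤ Lr := ENNReal.toReal_nonneg
  rw [ae_iff]
  set B : Set ℂ := {x | ¬ ∃ C : ℝ, 0 < C ∧ ∀ s : ℝ, 0 < s → μ (closedBall x s) ≤ ENNReal.ofReal (C * s)}
    with hB
  have hsel : ∀ n : ℕ, ∀ x : B, ∃ s : ℝ, 0 < s ∧ ENNReal.ofReal ((n + 1) * s) < μ (closedBall x.1 s) := by
    intro n x
    have := x.2
    simp only [hB, Set.mem_setOf_eq, not_exists, not_and, not_forall, not_le] at this
    obtain ⟨s, hs, h⟩ := this (n + 1) (by positivity)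
    exact ⟨s, hs, h⟩
  choose s hs0 hs using hsel
  have hsR : ∀ n x, s n x ≤ Lr / (n + 1) := by
    intro n x
    have h1 := (hs n x).le.trans (measure_mono (Set.subset_univ _))
    rw [hμu, hLe, ENNReal.ofReal_le_ofReal_iff hL0] at h1
    rw [le_div_iff₀ (by positivity)]
    linarith
  have hV : ∀ n, ∃ u : Set B, u.Countable ∧ (u.PairwiseDisjoint fun a => closedBall a.1 (s n a)) ∧
      ∀ a : B, ∃ b ∈ u, closedBall a.1 (s n a) ⊆ closedBall b.1 (5 * s n b) := by
    intro n
    obtain ⟨u, -, h1, h2⟩ := Vitali.exists_disjoint_subfamily_covering_enlargement_closedBall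
      (Set.univ : Set B) (fun a => a.1) (s n) (Lr / (n+1)) (fun a _ => hsR n a) 5 (by norm_num)
    refine ⟨u, ?_, h1, fun a => h2 a trivial⟩
    apply h1.countable_of_nonempty_interior
    intro i _
    exact ⟨i.1, ball_subset_interior_closedBall (mem_ball_self (hs0 n i))⟩
  choose u huc hud hucov using hV
  have : ∀ n, Countable (u n) := fun n => (huc n).to_subtype
  have hdiam : ∀ n (i : u n), ediam (closedBall i.1.1 (5 * s n i.1)) ≤ ENNReal.ofReal (10 * s n i.1) := by
    intro n i
    have := hs0 n i.1
    apply ediam_le_of_forall_dist_le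
    intro x hx y hy
    have h1 := dist_triangle_right x y i.1.1
    rw [mem_closedBall] at hx hy
    linarith
  have hlim : Filter.Tendsto (fun n : ℕ => ENNReal.ofReal (10 * (Lr / (n+1)))) Filter.atTop (nhds 0) := by
    have h1 : Filter.Tendsto (fun n : ℕ => 10 * (Lr / ((n:ℝ)+1))) Filter.atTop (nhds (10 * 0)) := by
      refine Filter.Tendsto.const_mul _ ?_
      have := tendsto_one_div_add_atTop_nhds_zero_nat (𝕜 := ℝ)
      have h2 := this.const_mul Lr
      simp only [mul_zero, mul_one_div] at h2
      exact h2
    have := ENNReal.tendsto_ofReal h1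
    simpa using this
  have key : μH[1] B ≤ Filter.liminf (fun n : ℕ => ∑' (i : u n), ediam (closedBall i.1.1 (5 * s n i.1)) ^ (1:ℝ))
      Filter.atTop := by
    refine Measure.hausdorffMeasure_le_liminf_tsum 1 B _ hlim _ ?_ ?_
    · refine Filter.Eventually.of_forall fun n i => (hdiam n i).trans ?_
      apply ENNReal.ofReal_le_ofReal
      have := hsR n i.1
      linarith
    · refine Filter.Eventually.of_forall fun n x hx => ?_
      obtain ⟨b, hb, h⟩ := hucov n ⟨x, hx⟩
      exact Set.mem_iUnion.2 ⟨⟨b, hb⟩, h (mem_closedBall_self (hs0 n _).le)⟩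
  have hsum : ∀ n : ℕ, ∑' (i : u n), ediam (closedBall i.1.1 (5 * s n i.1)) ^ (1:ℝ) ≤
      ENNReal.ofReal (10 * (Lr / (n+1))) := by
    intro n
    have h1 : ∀ i : u n, ediam (closedBall i.1.1 (5 * s n i.1)) ^ (1:ℝ) ≤
        ENNReal.ofReal (10 / (n+1)) * μ (closedBall i.1.1 (s n i.1)) := by
      intro i
      rw [ENNReal.rpow_one]
      refine (hdiam n i).trans ?_
      refine le_trans (le_of_eq ?_) (mul_le_mul_right (hs n i.1).le _)
      rw [← ENNReal.ofReal_mul (by positivity)]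
      congr 1
      field_simp
    refine (ENNReal.tsum_le_tsum h1).trans ?_
    rw [ENNReal.tsum_mul_left]
    have h2 : ∑' i : u n, μ (closedBall i.1.1 (s n i.1)) ≤ μ Set.univ := by
      rw [← measure_iUnion]
      · exact measure_mono (Set.subset_univ _)
      · intro i j hij
        exact hud n i.2 j.2 (fun h => hij (Subtype.ext h))
      · exact fun i => isClosed_closedBall.measurableSet
    refine (mul_le_mul_right h2 _).trans ?_
    rw [hμu, hLe, ← ENNReal.ofReal_mul (by positivity)]
    apply ENNReal.ofReal_le_ofReal
    apply le_of_eq; ring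
  have h0 : μH[1] B ≤ 0 := by
    refine key.trans ?_
    rw [← hlim.liminf_eq]
    exact Filter.liminf_le_liminf (Filter.Eventually.of_forall hsum)
  have h1 : μ B ≤ μH[1] B := Measure.restrict_apply_le _ _
  exact le_antisymm (h1.trans h0) zero_le

lemma ae_lower_density_aux {E : Set ℂ} (hE : IsCompact E) (hfin : μH[1] E ≠ ∞) {ε δ : ℝ} (hε : 0 < ε)
    (hδ : 0 < δ) :
    ∀ᵐ x ∂((μH[1]).restrict E), ∃ C : Set ℂ, x ∈ C ∧ ediam C ≠ 0 ∧ ediam C ≤ ENNReal.ofReal δ ∧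
      ENNReal.ofReal (1 - ε) * ediam C ≤ (μH[1]).restrict E C := by
  set μ : Measure ℂ := (μH[1]).restrict E with hμ
  rw [ae_iff]
  set B : Set ℂ := {x | ¬ ∃ C : Set ℂ, x ∈ C ∧ ediam C ≠ 0 ∧ ediam C ≤ ENNReal.ofReal δ ∧
      ENNReal.ofReal (1 - ε) * ediam C ≤ μ C} with hB
  have hEm := hE.isClosed.measurableSet
  set S := B ∩ E with hS
  have hμB : μ B = μH[1] S := Measure.restrict_apply' hEm
  have hSfin : μH[1] S ≠ ∞ := ((measure_mono Set.inter_subset_right).trans_lt hfin.lt_top).ne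
  have hμS : μ S = μH[1] S := by rw [hμ, Measure.restrict_apply' hEm, hS, Set.inter_assoc, Set.inter_self]
  have hle : ∀ a : ℝ≥0∞, 0 < a → μH[1] S ≤ ENNReal.ofReal (1 - ε) * (μH[1] S + a) := by
    intro a ha
    obtain ⟨t, h1, h2, h3⟩ := exists_cover_sets S hSfin (δ := ENNReal.ofReal δ) (by simpa using hδ) ha
    have hn : ∀ n, μ (t n ∩ S) ≤ ENNReal.ofReal (1 - ε) * ediam (t n) := by
      intro n
      by_cases hne : (t n ∩ S).Nonempty
      · obtain ⟨x, hx, hxS⟩ := hne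
        by_cases hd : ediam (t n) = 0
        · have hsub : (t n).Subsingleton := ediam_eq_zero_iff.1 hd
          have h0 : μ (t n) = 0 := by
            refine le_antisymm ((Measure.restrict_apply_le _ _).trans ?_) zero_le
            have := Measure.nullSingletonClass_hausdorff ℂ (d := 1) one_pos
            exact (hsub.measure_zero _).le
          exact (measure_mono Set.inter_subset_left).trans (by rw [h0]; exact zero_le)
        · have := hxS.1
          simp only [hB, Set.mem_setOf_eq, not_exists, not_and, not_le] at this
          exact (measure_mono Set.inter_subset_left).trans (this (t n) hx hd (h2 n)).le
      · rw [Set.not_nonempty_iff_eq_empty.1 hne]; simp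
    calc μH[1] S = μ S := hμS.symm
      _ ≤ μ (⋃ n, t n ∩ S) := by
          apply measure_mono
          intro x hx
          obtain ⟨n, hn⟩ := Set.mem_iUnion.1 (h1 hx)
          exact Set.mem_iUnion.2 ⟨n, hn, hx⟩
      _ ≤ ∑' n, μ (t n ∩ S) := measure_iUnion_le _
      _ ≤ ∑' n, ENNReal.ofReal (1 - ε) * ediam (t n) := ENNReal.tsum_le_tsum hn
      _ = ENNReal.ofReal (1 - ε) * ∑' n, ediam (t n) := ENNReal.tsum_mul_left
      _ ≤ _ := mul_le_mul_right h3 _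
  rw [hμB]
  by_contra hne
  set m := (μH[1] S).toReal with hm
  have hme : μH[1] S = ENNReal.ofReal m := (ENNReal.ofReal_toReal hSfin).symm
  have hm0 : 0 < m := ENNReal.toReal_pos hne hSfin
  have h := hle (ENNReal.ofReal (ε * m)) (by simp; positivity)
  rw [hme, ← ENNReal.ofReal_add hm0.le (by positivity)] at h
  by_cases h1 : 1 - ε ≤ 0
  · rw [ENNReal.ofReal_of_nonpos h1, zero_mul, nonpos_iff_eq_zero, ENNReal.ofReal_eq_zero] at h
    linarith
  · push Not at h1
    rw [← ENNReal.ofReal_mul h1.le, ENNReal.ofReal_le_ofReal_iff (by positivity)] at h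
    have : 0 < ε ^ 2 * m := by positivity
    nlinarith

lemma ae_lower_density {E : Set ℂ} (hE : IsCompact E) (hfin : μH[1] E ≠ ∞) :
    ∀ᵐ x ∂((μH[1]).restrict E), ∀ ε > 0, ∀ δ > 0, ∃ C : Set ℂ, x ∈ C ∧ 0 < diam C ∧ diam C ≤ δ ∧
      Bornology.IsBounded C ∧
      ENNReal.ofReal ((1 - ε) * diam C) ≤ (μH[1]).restrict E C := by
  have h : ∀ᵐ x ∂((μH[1]).restrict E), ∀ n : ℕ, ∃ C : Set ℂ, x ∈ C ∧ ediam C ≠ 0 ∧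
      ediam C ≤ ENNReal.ofReal (1 / (n + 1)) ∧
      ENNReal.ofReal (1 - 1 / (n+1)) * ediam C ≤ (μH[1]).restrict E C := by
    rw [ae_all_iff]
    intro n
    exact ae_lower_density_aux hE hfin (by positivity) (by positivity)
  filter_upwards [h] with x hx ε hε δ hδ
  obtain ⟨n, hn⟩ := exists_nat_one_div_lt (lt_min hε hδ)
  obtain ⟨C, h1, h2, h3, h4⟩ := hx n
  have hfinC : ediam C ≠ ∞ := (h3.trans_lt ENNReal.ofReal_lt_top).ne
  have hn1 := hn.trans_le (min_le_left _ _)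
  have hn2 := hn.trans_le (min_le_right _ _)
  have hd : 0 < diam C := ENNReal.toReal_pos h2 hfinC
  refine ⟨C, h1, hd, ?_, isBounded_iff_ediam_ne_top.2 hfinC, ?_⟩
  · exact (ENNReal.toReal_le_of_le_ofReal (by positivity) h3).trans hn2.le
  · refine le_trans ?_ h4
    have : ediam C = ENNReal.ofReal (diam C) := (ENNReal.ofReal_toReal hfinC).symm
    have hle1 : (1:ℝ) / (n+1) ≤ 1 := by
      rw [div_le_one (by positivity)]; linarith [Nat.cast_nonneg (α := ℝ) n]
    rw [this, ← ENNReal.ofReal_mul (by linarith)]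
    apply ENNReal.ofReal_le_ofReal
    gcongr

lemma ae_lebesgue {E : Set ℂ} (hE : IsCompact E) (hfin : μH[1] E ≠ ∞) {b : ℂ → ℂ}
    (hb : Integrable b ((μH[1]).restrict E)) :
    ∀ᵐ x ∂((μH[1]).restrict E), ∀ τ > 0, ∃ r0 > 0, ∀ r, 0 < r → r < r0 →
      ∫⁻ y in closedBall x r, ‖b y - b x‖ₑ ∂((μH[1]).restrict E) ≤ ENNReal.ofReal (τ * r) := by
  have : Fact (μH[1] E < ∞) := ⟨hfin.lt_top⟩
  set μ : Measure ℂ := (μH[1]).restrict E with hμ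
  have h1 := (Besicovitch.vitaliFamily μ).ae_tendsto_lintegral_enorm_sub_div hb.locallyIntegrable
  filter_upwards [h1, ae_upper_density hE hfin] with x hx hC τ hτ
  obtain ⟨C, hC0, hC⟩ := hC
  have h2 := hx.comp (Besicovitch.tendsto_filterAt μ x)
  have h3 := h2.eventually (gt_mem_nhds (show (0:ℝ≥0∞) < ENNReal.ofReal (τ / C) by simp; positivity))
  rw [eventually_nhdsWithin_iff, Metric.eventually_nhds_iff] at h3
  obtain ⟨r0, hr0, h3⟩ := h3
  refine ⟨r0, hr0, fun r hr hrr => ?_⟩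
  have h4 := h3 (y := r) (by simpa [abs_of_pos hr] using hrr) hr
  simp only [Function.comp_apply] at h4
  by_cases h0 : μ (closedBall x r) = 0
  · rw [Measure.restrict_eq_zero.2 h0]; simp
  · have h5 := (ENNReal.div_le_iff h0 (measure_ne_top μ _)).1 h4.le
    refine h5.trans ((mul_le_mul_right (hC r hr) _).trans (le_of_eq ?_))
    rw [← ENNReal.ofReal_mul (by positivity)]
    congr 1
    field_simp

end Cell


namespace Cell
open scoped ENNReal

/-- Radial cutoff vanishing near the origin. -/
noncomputable def kF (δ : ℝ) (z : ℂ) : ℝ := smoothTransition (2 / δ ^ 2 * Complex.normSq z - 1)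

/-- Regularised Cauchy kernel. -/
noncomputable def kK (δ : ℝ) (z : ℂ) : ℂ := (kF δ z : ℂ) * z⁻¹

/-- The approximate identity. -/
noncomputable def kP (δ : ℝ) (z : ℂ) : ℝ :=
  2 / δ ^ 2 * deriv smoothTransition (2 / δ ^ 2 * Complex.normSq z - 1)

lemma contDiff_normSq : ContDiff ℝ 1 (fun z : ℂ => Complex.normSq z) := by
  have : (fun z : ℂ => Complex.normSq z) = fun z : ℂ => ‖z‖ ^ 2 := by
    ext z; rw [Complex.normSq_eq_norm_sq]
  rw [this]
  exact contDiff_norm_sq ℝ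

lemma contDiff_kF (δ : ℝ) : ContDiff ℝ 1 (kF δ) := by
  unfold kF
  exact (smoothTransition.contDiff (n := 1)).comp ((contDiff_const.mul contDiff_normSq).sub contDiff_const)

lemma kF_zero {δ : ℝ} (hδ : 0 < δ) {z : ℂ} (hz : Complex.normSq z ≤ δ ^ 2 / 2) : kF δ z = 0 := by
  apply smoothTransition.zero_of_nonpos
  have : 2 / δ ^ 2 * Complex.normSq z ≤ 2 / δ ^ 2 * (δ ^ 2 / 2) := by gcongr
  have h2 : 2 / δ ^ 2 * (δ ^ 2 / 2) = 1 := by field_simp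
  linarith

lemma kF_one {δ : ℝ} (hδ : 0 < δ) {z : ℂ} (hz : δ ≤ ‖z‖) : kF δ z = 1 := by
  apply smoothTransition.one_of_one_le
  rw [Complex.normSq_eq_norm_sq]
  have h1 : δ ^ 2 ≤ ‖z‖ ^ 2 := by gcongr
  have : 2 / δ ^ 2 * δ ^ 2 ≤ 2 / δ ^ 2 * ‖z‖ ^ 2 := by gcongr
  have h2 : 2 / δ ^ 2 * δ ^ 2 = 2 := by field_simp
  linarith

lemma kF_ev {δ : ℝ} (hδ : 0 < δ) : ∀ᶠ z in nhds (0:ℂ), kF δ z = 0 := by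
  have : ∀ᶠ z in nhds (0:ℂ), Complex.normSq z < δ ^ 2 / 2 :=
    contDiff_normSq.continuous.continuousAt.eventually_lt continuousAt_const (by simp; positivity)
  filter_upwards [this] with z hz using kF_zero hδ hz.le

lemma contDiff_kK {δ : ℝ} (hδ : 0 < δ) : ContDiff ℝ 1 (kK δ) := by
  rw [contDiff_iff_contDiffAt]
  intro z
  by_cases hz : z = 0
  · subst hz
    have : kK δ =ᶠ[nhds 0] fun _ => 0 := by
      filter_upwards [kF_ev hδ] with w hw
      simp [kK, hw]
    exact contDiffAt_const.congr_of_eventuallyEq this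
  · unfold kK
    refine ContDiffAt.mul ?_ ?_
    · exact (Complex.ofRealCLM.contDiff.comp (contDiff_kF δ)).contDiffAt
    · exact (contDiffAt_inv ℂ hz).restrict_scalars ℝ

lemma norm_kK_le (δ : ℝ) (z : ℂ) : ‖kK δ z‖ ≤ ‖z‖⁻¹ := by
  unfold kK
  rw [norm_mul, norm_inv, Complex.norm_real, Real.norm_eq_abs, abs_of_nonneg (show 0 ≤ kF δ z from smoothTransition.nonneg _)]
  exact mul_le_of_le_one_left (by positivity) (smoothTransition.le_one _)

lemma kK_eq {δ : ℝ} (hδ : 0 < δ) {z : ℂ} (hz : δ ≤ ‖z‖) : kK δ z = z⁻¹ := by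
  simp [kK, kF_one hδ hz]

lemma hasFDerivAt_kF (δ : ℝ) (z v : ℂ) :
    fderiv ℝ (kF δ) z v = kP δ z * (2 * (z.re * v.re + z.im * v.im)) := by
  have h1 : HasDerivAt smoothTransition (deriv smoothTransition (2 / δ ^ 2 * Complex.normSq z - 1))
      (2 / δ ^ 2 * Complex.normSq z - 1) :=
    ((smoothTransition.contDiff (n := 1)).differentiable one_ne_zero _).hasDerivAt
  have hre : HasFDerivAt (fun z : ℂ => z.re) Complex.reCLM z := Complex.reCLM.hasFDerivAt
  have him : HasFDerivAt (fun z : ℂ => z.im) Complex.imCLM z := Complex.imCLM.hasFDerivAt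
  have h2 := (((hre.mul hre).add (him.mul him)).const_mul (2 / δ ^ 2)).sub_const 1
  have h3 := h1.comp_hasFDerivAt z h2
  have h4 : (smoothTransition ∘ fun x : ℂ => 2 / δ ^ 2 * (x.re * x.re + x.im * x.im) - 1) = kF δ := by
    ext w; simp [kF, Complex.normSq_apply]
  have h5 : HasFDerivAt (kF δ) _ z := h3
  rw [h5.fderiv]
  simp [kP]
  ring

lemma dbar_kK {δ : ℝ} (hδ : 0 < δ) (z : ℂ) : dbar (kK δ) z = kP δ z := by
  by_cases hz : z = 0
  · subst hz
    have : kK δ =ᶠ[nhds 0] fun _ => 0 := by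
      filter_upwards [kF_ev hδ] with w hw
      simp [kK, hw]
    rw [dbar_congr this]
    have h2 : kP δ 0 = 0 := by
      have h3 : deriv smoothTransition (-1) = 0 := by
        have : smoothTransition =ᶠ[nhds (-1)] fun _ => 0 := by
          filter_upwards [gt_mem_nhds (show (-1:ℝ) < 0 by norm_num)] with x hx
          exact smoothTransition.zero_of_nonpos hx.le
        rw [this.deriv_eq]; simp
      simp [kP, h3]
    simp [dbar, h2]
  · have hF : ContDiff ℝ 1 (fun w => (kF δ w : ℂ)) := Complex.ofRealCLM.contDiff.comp (contDiff_kF δ)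
    have hi : DifferentiableAt ℂ (fun w : ℂ => w⁻¹) z := differentiableAt_inv hz
    have h1 := dbar_mul (f := fun w => (kF δ w : ℂ)) (g := fun w : ℂ => w⁻¹) (z := z)
      (hF.differentiable one_ne_zero z) (hi.restrictScalars ℝ)
    change dbar (fun w => (kF δ w : ℂ) * w⁻¹) z = _
    rw [h1, dbar_holo hi]
    have h2 : ∀ v, fderiv ℝ (fun w => (kF δ w : ℂ)) z v = ((fderiv ℝ (kF δ) z v : ℝ) : ℂ) := by
      intro v
      have h3 := ((contDiff_kF δ).differentiable one_ne_zero z).hasFDerivAt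
      have h4 := Complex.ofRealCLM.hasFDerivAt.comp z h3
      have h5 : HasFDerivAt (fun w => (kF δ w : ℂ)) _ z := h4
      rw [h5.fderiv]; rfl
    unfold dbar
    rw [h2, h2, hasFDerivAt_kF, hasFDerivAt_kF]
    simp only [Complex.one_re, Complex.one_im, Complex.I_re, Complex.I_im, mul_one, mul_zero, add_zero,
      zero_add]
    push_cast
    have h6 : (z.re : ℂ) + Complex.I * z.im = z := by
      rw [mul_comm]; exact Complex.re_add_im z
    calc _ = z⁻¹ * (kP δ z * ((z.re : ℂ) + Complex.I * z.im)) := by ring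
      _ = _ := by rw [h6]; field_simp

lemma st_deriv_zero {x : ℝ} (hx : x ≤ 0 ∨ 1 ≤ x) : deriv smoothTransition x = 0 := by
  rcases hx with hx | hx
  · apply IsLocalMin.deriv_eq_zero
    apply Filter.Eventually.of_forall
    intro y
    rw [smoothTransition.zero_of_nonpos hx]; exact smoothTransition.nonneg y
  · apply IsLocalMax.deriv_eq_zero
    apply Filter.Eventually.of_forall
    intro y
    rw [smoothTransition.one_of_one_le hx]; exact smoothTransition.le_one y

lemma st_deriv_nonneg (x : ℝ) : 0 ≤ deriv smoothTransition x :=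
  smoothTransition.monotone.deriv_nonneg

lemma continuous_st_deriv : Continuous (deriv smoothTransition) :=
  (smoothTransition.contDiff (n := 1)).continuous_deriv le_rfl

lemma exists_st_bound : ∃ C : ℝ, 0 < C ∧ ∀ x, deriv smoothTransition x ≤ C := by
  obtain ⟨C, hC⟩ := isCompact_Icc (a := (0:ℝ)) (b := 1) |>.exists_bound_of_continuousOn
    continuous_st_deriv.continuousOn
  refine ⟨max C 1, by positivity, fun x => ?_⟩
  by_cases hx : x ∈ Set.Icc (0:ℝ) 1
  · exact (le_abs_self _).trans ((hC x hx).trans (le_max_left _ _))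
  · rw [st_deriv_zero]
    · positivity
    · simp only [Set.mem_Icc, not_and_or, not_le] at hx
      exact hx.imp le_of_lt le_of_lt

lemma continuous_kP (δ : ℝ) : Continuous (kP δ) := by
  unfold kP
  have := contDiff_normSq.continuous
  exact continuous_const.mul (continuous_st_deriv.comp (by fun_prop))

lemma kP_nonneg (δ : ℝ) (z : ℂ) : 0 ≤ kP δ z := mul_nonneg (by positivity) (st_deriv_nonneg _)

lemma kP_zero {δ : ℝ} (hδ : 0 < δ) {z : ℂ} (hz : δ ≤ ‖z‖) : kP δ z = 0 := by
  unfold kP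
  rw [st_deriv_zero, mul_zero]
  right
  rw [Complex.normSq_eq_norm_sq]
  have h1 : δ ^ 2 ≤ ‖z‖ ^ 2 := by gcongr
  have : 2 / δ ^ 2 * δ ^ 2 ≤ 2 / δ ^ 2 * ‖z‖ ^ 2 := by gcongr
  have h2 : 2 / δ ^ 2 * δ ^ 2 = 2 := by field_simp
  linarith

lemma exists_kP_bound : ∃ C : ℝ, 0 < C ∧ ∀ δ z, 0 < δ → kP δ z ≤ C / δ ^ 2 := by
  obtain ⟨C, hC, h⟩ := exists_st_bound
  refine ⟨2 * C, by positivity, fun δ z hδ => ?_⟩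
  unfold kP
  calc _ ≤ 2 / δ ^ 2 * C := by gcongr; exact h _
    _ = _ := by ring

lemma integral_kP {δ : ℝ} (hδ : 0 < δ) : ∫ z, kP δ z = π := by
  have h1 := integral_fun_norm_addHaar (E := ℂ) volume
    (fun y : ℝ => 2 / δ ^ 2 * deriv smoothTransition (2 / δ ^ 2 * y ^ 2 - 1))
  have h2 : (fun z : ℂ => 2 / δ ^ 2 * deriv smoothTransition (2 / δ ^ 2 * ‖z‖ ^ 2 - 1)) = kP δ := by
    ext z; simp [kP, Complex.normSq_eq_norm_sq]
  rw [h2] at h1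
  rw [h1]
  have h3 : ∫ y in Set.Ioi (0:ℝ), y ^ (2 - 1) • (2 / δ ^ 2 * deriv smoothTransition (2 / δ ^ 2 * y ^ 2 - 1))
      = 1 / 2 - 1 / 2 * smoothTransition (2 / δ ^ 2 * 0 ^ 2 - 1) := by
    refine integral_Ioi_of_hasDerivAt_of_nonneg' (g := fun y => 1 / 2 * smoothTransition (2 / δ ^ 2 * y ^ 2 - 1))
      ?_ ?_ ?_
    · intro y _
      have a1 : HasDerivAt smoothTransition (deriv smoothTransition (2 / δ ^ 2 * y ^ 2 - 1))
        (2 / δ ^ 2 * y ^ 2 - 1) :=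
        ((smoothTransition.contDiff (n := 1)).differentiable one_ne_zero _).hasDerivAt
      have a2 : HasDerivAt (fun y : ℝ => 2 / δ ^ 2 * y ^ 2 - 1) (2 / δ ^ 2 * (2 * y)) y := by
        have := ((hasDerivAt_pow 2 y).const_mul (2 / δ ^ 2)).sub_const 1
        simpa using this
      have a3 := (a1.comp y a2).const_mul (1/2)
      have a4 : y ^ (2 - 1) • (2 / δ ^ 2 * deriv smoothTransition (2 / δ ^ 2 * y ^ 2 - 1)) =
        1 / 2 * (deriv smoothTransition (2 / δ ^ 2 * y ^ 2 - 1) * (2 / δ ^ 2 * (2 * y))) := by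
        rw [smul_eq_mul]; ring
      rw [a4]
      exact a3
    · intro y hy
      have hy' : 0 < y := hy
      have := st_deriv_nonneg (2 / δ ^ 2 * y ^ 2 - 1)
      simp only [smul_eq_mul]
      positivity
    · apply tendsto_const_nhds.congr'
      filter_upwards [Filter.eventually_ge_atTop δ] with y hy
      rw [smoothTransition.one_of_one_le]; · norm_num
      have h1 : δ ^ 2 ≤ y ^ 2 := by gcongr
      have : 2 / δ ^ 2 * δ ^ 2 ≤ 2 / δ ^ 2 * y ^ 2 := by gcongr
      have h2 : 2 / δ ^ 2 * δ ^ 2 = 2 := by field_simp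
      linarith
  rw [Complex.finrank_real_complex, h3, smoothTransition.zero_of_nonpos (by norm_num)]
  simp [Measure.real, Complex.volume_ball]
  ring

lemma lintegral_inv_ball (w : ℂ) {R : ℝ} (hR : 0 < R) :
    ∫⁻ z in ball w R, ENNReal.ofReal ‖w - z‖⁻¹ ≤ ENNReal.ofReal (2 * π * R) := by
  have h1 : ∫⁻ z in ball w R, ENNReal.ofReal ‖w - z‖⁻¹ =
      ∫⁻ z, (ball (0:ℂ) R).indicator (fun z => ENNReal.ofReal ‖z‖⁻¹) z := by
    rw [← lintegral_indicator measurableSet_ball]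
    rw [← lintegral_sub_right_eq_self (μ := (volume : Measure ℂ))
      (fun z => (ball (0:ℂ) R).indicator (fun z => ENNReal.ofReal ‖z‖⁻¹) z) w]
    congr 1; ext z
    simp only [Set.indicator, mem_ball, dist_eq_norm, sub_zero]
    rw [norm_sub_rev w z]
  rw [h1, ← Complex.lintegral_comp_polarCoord_symm]
  calc _ ≤ ∫⁻ p in Set.Ioi (0:ℝ) ×ˢ Set.Ioo (-π) π, (Set.Ioo (0:ℝ) R ×ˢ Set.Ioo (-π) π).indicator 1 p := by
        rw [polarCoord_target]
        refine setLIntegral_mono' (measurableSet_Ioi.prod measurableSet_Ioo) ?_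
        intro p hp
        have hp1 : 0 < p.1 := hp.1
        have hn : ‖Complex.polarCoord.symm p‖ = p.1 := by
          rw [Complex.norm_polarCoord_symm, abs_of_pos hp1]
        by_cases h : p.1 < R
        · have : p ∈ Set.Ioo (0:ℝ) R ×ˢ Set.Ioo (-π) π := ⟨⟨hp1, h⟩, hp.2⟩
          rw [Set.indicator_of_mem this, Set.indicator_of_mem (by simpa [abs_of_pos hp1] using h)]
          rw [hn, smul_eq_mul, ← ENNReal.ofReal_mul hp1.le, mul_inv_cancel₀ hp1.ne']
          simp
        · rw [Set.indicator_of_notMem (by simpa [abs_of_pos hp1] using h)]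
          simp
    _ ≤ ∫⁻ p, (Set.Ioo (0:ℝ) R ×ˢ Set.Ioo (-π) π).indicator 1 p := setLIntegral_le_lintegral _ _
    _ = volume (Set.Ioo (0:ℝ) R ×ˢ Set.Ioo (-π) π) := by
        rw [lintegral_indicator_one (measurableSet_Ioo.prod measurableSet_Ioo)]
    _ = ENNReal.ofReal R * ENNReal.ofReal (2 * π) := by
        rw [Measure.volume_eq_prod, Measure.prod_prod, Real.volume_Ioo, Real.volume_Ioo]
        congr 2 <;> ring
    _ ≤ _ := by
        rw [← ENNReal.ofReal_mul hR.le]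
        apply le_of_eq; congr 1; ring

lemma lintegral_inv_ball_any (w x : ℂ) {R : ℝ} (hR : 0 < R) :
    ∫⁻ z in ball x R, ENNReal.ofReal ‖w - z‖⁻¹ ≤ ENNReal.ofReal (3 * π * R) := by
  have hmeas : Measurable (fun z : ℂ => ENNReal.ofReal ‖w - z‖⁻¹) := by fun_prop
  calc _ ≤ ∫⁻ z in ball x R, ((ball w R).indicator (fun z => ENNReal.ofReal ‖w - z‖⁻¹) z +
        ENNReal.ofReal R⁻¹) := by
        refine lintegral_mono fun z => ?_
        by_cases h : z ∈ ball w R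
        · rw [Set.indicator_of_mem h]; exact le_self_add
        · rw [Set.indicator_of_notMem h, zero_add]
          apply ENNReal.ofReal_le_ofReal
          rw [mem_ball, dist_eq_norm, not_lt, norm_sub_rev] at h
          gcongr
    _ = (∫⁻ z in ball x R, (ball w R).indicator (fun z => ENNReal.ofReal ‖w - z‖⁻¹) z) +
        ENNReal.ofReal R⁻¹ * volume (ball x R) := by
        rw [lintegral_add_right _ measurable_const, setLIntegral_const]
    _ ≤ ENNReal.ofReal (2 * π * R) + ENNReal.ofReal (π * R) := by
        gcongr
        · refine (setLIntegral_le_lintegral _ _).trans ?_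
          rw [lintegral_indicator measurableSet_ball]
          exact lintegral_inv_ball w hR
        · rw [Complex.volume_ball, ← ENNReal.ofReal_pow hR.le]
          have : (NNReal.pi : ℝ≥0∞) = ENNReal.ofReal π := by
            rw [← NNReal.coe_real_pi, ENNReal.ofReal_coe_nnreal]
          rw [this, ← ENNReal.ofReal_mul (by positivity), ← ENNReal.ofReal_mul (by positivity)]
          apply le_of_eq; congr 1; field_simp
    _ = _ := by
        rw [← ENNReal.ofReal_add (by positivity) (by positivity)]
        congr 1; ring

end Cell


namespace Cell
open scoped ENNReal

lemma kP_compact {δ : ℝ} (hδ : 0 < δ) (z : ℂ) : HasCompactSupport (fun w => (kP δ (w - z) : ℂ)) := by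
  refine HasCompactSupport.intro (isCompact_closedBall z δ) ?_
  intro w hw
  rw [mem_closedBall, dist_eq_norm, not_le] at hw
  simp [kP_zero hδ hw.le]

lemma kP_continuous (δ : ℝ) (z : ℂ) : Continuous (fun w => (kP δ (w - z) : ℂ)) := by
  have := continuous_kP δ
  fun_prop

lemma kP_integrable {δ : ℝ} (hδ : 0 < δ) (z : ℂ) : Integrable (fun w => (kP δ (w - z) : ℂ)) :=
  (kP_continuous δ z).integrable_of_hasCompactSupport (kP_compact hδ z)

lemma kP_int {δ : ℝ} (hδ : 0 < δ) (z : ℂ) : ∫ w, (kP δ (w - z) : ℂ) = π := by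
  rw [integral_sub_right_eq_self (fun w => (kP δ w : ℂ)), integral_complex_ofReal, integral_kP hδ]

lemma kP_diff {δ : ℝ} (hδ : 0 < δ) {v : ℂ → ℂ} {V : ℝ} (hv : Measurable v) (hV : ∀ z, ‖v z‖ ≤ V) (z : ℂ) :
    (∫ w, v w * kP δ (w - z)) - π * v z = ∫ w, (v w - v z) * kP δ (w - z) := by
  have h1 : Integrable (fun w => v w * (kP δ (w - z) : ℂ)) :=
    (kP_integrable hδ z).bdd_mul hv.aestronglyMeasurable (Filter.Eventually.of_forall hV)
  have h2 := (kP_integrable hδ z).const_mul (v z)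
  simp_rw [sub_mul]
  rw [integral_sub h1 h2, integral_const_mul, kP_int hδ]
  ring

lemma kP_close {δ ε : ℝ} (hδ : 0 < δ) {v : ℂ → ℂ} {V : ℝ} (hv : Measurable v) (hV : ∀ z, ‖v z‖ ≤ V) (z : ℂ)
    (hclose : ∀ w ∈ closedBall z δ, ‖v w - v z‖ ≤ ε) :
    ‖(∫ w, v w * kP δ (w - z)) - π * v z‖ ≤ ε * π := by
  rw [kP_diff hδ hv hV]
  have h1 : Integrable (fun w => ε * kP δ (w - z)) := by
    have := (kP_integrable hδ z).re
    simp only [RCLike.re_to_complex, Complex.ofReal_re] at this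
    exact this.const_mul ε
  refine (norm_integral_le_of_norm_le h1 (Filter.Eventually.of_forall ?_)).trans ?_
  · intro w
    rw [norm_mul, Complex.norm_real, Real.norm_eq_abs, abs_of_nonneg (kP_nonneg _ _)]
    by_cases hw : w ∈ closedBall z δ
    · exact mul_le_mul_of_nonneg_right (hclose w hw) (kP_nonneg _ _)
    · rw [mem_closedBall, dist_eq_norm, not_le] at hw
      simp [kP_zero hδ hw.le]
  · rw [integral_const_mul, integral_sub_right_eq_self (kP δ), integral_kP hδ]

lemma kP_limit {v : ℂ → ℂ} {V : ℝ} (hv : Measurable v) (hV : ∀ z, ‖v z‖ ≤ V) :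
    ∀ᵐ z, Filter.Tendsto (fun δ : ℝ => ∫ w, v w * kP δ (w - z)) (nhdsWithin 0 (Set.Ioi 0)) (nhds (π * v z)) := by
  obtain ⟨C, hC, hP⟩ := exists_kP_bound
  have hloc : LocallyIntegrable v := by
    have : LocallyIntegrable (fun _ : ℂ => V) := locallyIntegrable_const V
    exact this.mono hv.aestronglyMeasurable (Filter.Eventually.of_forall fun z =>
      (hV z).trans (le_abs_self _))
  have h := IsUnifLocDoublingMeasure.ae_tendsto_average_norm_sub (volume : Measure ℂ) hloc 1
  filter_upwards [h] with z hz
  have h1 := hz (l := nhdsWithin (0:ℝ) (Set.Ioi 0)) (fun _ => z) (fun δ => δ) Filter.tendsto_id (by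
    filter_upwards [self_mem_nhdsWithin] with δ hδ
    exact mem_closedBall_self (by simpa using (show (0:ℝ) < δ from hδ).le))
  rw [tendsto_iff_norm_sub_tendsto_zero]
  have h2 := h1.const_mul (C * π)
  rw [mul_zero] at h2
  refine squeeze_zero' (Filter.Eventually.of_forall fun δ => norm_nonneg _) ?_ h2
  filter_upwards [self_mem_nhdsWithin] with δ hδ
  have hδ' : 0 < δ := hδ
  rw [kP_diff hδ' hv hV]
  have hintA : IntegrableOn (fun w => ‖v w - v z‖) (closedBall z δ) := by
    have := (hloc.integrableOn_isCompact (isCompact_closedBall z δ)).sub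
      (integrableOn_const (C := v z) (isCompact_closedBall z δ).measure_ne_top)
    exact this.norm
  have h3 : Integrable (fun w => (closedBall z δ).indicator (fun w => C / δ ^ 2 * ‖v w - v z‖) w) := by
    rw [integrable_indicator_iff isClosed_closedBall.measurableSet]
    exact hintA.const_mul _
  refine (norm_integral_le_of_norm_le h3 (Filter.Eventually.of_forall ?_)).trans ?_
  · intro w
    rw [norm_mul, Complex.norm_real, Real.norm_eq_abs, abs_of_nonneg (kP_nonneg _ _)]
    by_cases hw : w ∈ closedBall z δ
    · rw [Set.indicator_of_mem hw, mul_comm]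
      exact mul_le_mul_of_nonneg_right (hP δ _ hδ') (norm_nonneg _)
    · rw [Set.indicator_of_notMem hw]
      rw [mem_closedBall, dist_eq_norm, not_le] at hw
      simp [kP_zero hδ' hw.le]
  · rw [integral_indicator isClosed_closedBall.measurableSet, integral_const_mul, setAverage_eq]
    have : volume.real (closedBall z δ) = π * δ ^ 2 := by
      simp [Measure.real, Complex.volume_closedBall, hδ'.le, mul_comm]
    rw [this, smul_eq_mul]
    apply le_of_eq
    field_simp

lemma near_const : ∃ c : ℝ, 0 < c ∧ ∀ (μ : Measure ℂ) [IsFiniteMeasure μ] (v b : ℂ → ℂ) (V e N r : ℝ) (x : ℂ),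
    Measurable v → (∀ z, ‖v z‖ ≤ V) → 6 ≤ N → 0 < r → 0 ≤ e → Integrable b μ →
    (∀ χ, Test (closedBall x (2 * (N * r))) χ → ∫ z, v z * dbar χ z = ∫ z, χ z * b z ∂μ) →
    (∫⁻ y in closedBall x (2 * (N * r)), ‖b y‖ₑ ∂μ ≤ ENNReal.ofReal e) →
    ∃ k : ℂ, ∫⁻ z in ball x (3 * r), ‖v z - k‖ₑ ≤ ENNReal.ofReal (c * (r * e + r ^ 2 * V / N)) := by
  obtain ⟨C, hC, hcut⟩ := exists_cutoff
  refine ⟨9 * π + 24 * π * C * (9 * π), by positivity, ?_⟩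
  intro μ _ v b V e N r x hv hV hN hr he hb htest hbe
  have hN0 : 0 < N := by linarith
  have hV0 : 0 ≤ V := (norm_nonneg _).trans (hV 0)
  have hNr : 6 * r ≤ N * r := by gcongr
  have hNr0 : 0 < N * r := by positivity
  obtain ⟨η, η1, η2, η3, η4, η5, η6⟩ := hcut x (N * r) (by positivity)
  have hηc : HasCompactSupport η := (isCompact_closedBall x _).of_isClosed_subset (isClosed_tsupport _) η3
  have hd0 : ∀ w ∈ ball x (N * r), dbar η w = 0 := by
    intro w hw
    have : η =ᶠ[nhds w] fun _ => 1 := by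
      filter_upwards [isOpen_ball.mem_nhds hw] with y hy
      exact η2 y (ball_subset_closedBall hy)
    rw [dbar_congr this]; simp [dbar]
  have hd1 : ∀ w, w ∉ closedBall x (2 * (N * r)) → dbar η w = 0 := fun w hw =>
    dbar_zero_of fun h => hw (η3 h)
  have hdb : ∀ w, ‖dbar η w‖ ≤ C / (N * r) := fun w => (norm_dbar_le _ _).trans (η6 w)
  have hfar : ∀ z ∈ ball x (3 * r), ∀ w, dbar η w ≠ 0 → N * r ≤ ‖w - x‖ ∧ N * r / 2 ≤ ‖w - z‖ := by
    intro z hz w hw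
    have h1 : N * r ≤ ‖w - x‖ := by
      by_contra h
      exact hw (hd0 w (by rw [mem_ball, dist_eq_norm]; push Not at h; exact h))
    rw [mem_ball, dist_eq_norm] at hz
    have h2 : ‖w - x‖ ≤ ‖w - z‖ + ‖z - x‖ := by
      have := norm_add_le (w - z) (z - x); simpa using this
    refine ⟨h1, by linarith⟩
  have hker : ∀ z, Integrable (fun w => v w * (dbar η w * kK r (w - z))) := by
    intro z
    have c1 : Continuous (fun w => dbar η w * kK r (w - z)) := by
      have := continuous_dbar η1
      have := (contDiff_kK hr).continuous
      fun_prop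
    exact (c1.integrable_of_hasCompactSupport (compact_dbar hηc).mul_right).bdd_mul hv.aestronglyMeasurable
      (Filter.Eventually.of_forall hV)
  set S : ℂ → ℂ := fun z => - ∫ w, v w * (dbar η w * kK r (w - z)) with hS
  set G : ℂ → ℝ≥0∞ := fun z => ∫⁻ y in closedBall x (2 * (N * r)), ‖b y‖ₑ * ENNReal.ofReal ‖y - z‖⁻¹ ∂μ with hG
  have step1 : ∀ z ∈ ball x (3 * r), ∀ δ, 0 < δ → δ < r → ‖(∫ w, v w * kP δ (w - z)) - S z‖ₑ ≤ G z := by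
    intro z hz δ hδ hδr
    set χ : ℂ → ℂ := fun w => η w * kK δ (w - z) with hχ
    have k1 : ContDiff ℝ 1 (fun w => kK δ (w - z)) := (contDiff_kK hδ).comp (contDiff_id.sub contDiff_const)
    have hT : Test (closedBall x (2 * (N * r))) χ :=
      ⟨η1.mul k1, hηc.mul_right, (tsupport_mul_subset_left).trans η3⟩
    have hdχ : ∀ w, dbar χ w = kP δ (w - z) + dbar η w * kK r (w - z) := by
      intro w
      have a1 : dbar (fun w => kK δ (w - z)) w = kP δ (w - z) := by
        rw [← dbar_kK hδ]
        unfold dbar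
        rw [show (fun w => kK δ (w - z)) = fun w => kK δ (w + -z) from by ext; rw [sub_eq_add_neg],
          fderiv_comp_add_right, ← sub_eq_add_neg]
      rw [hχ, dbar_mul (η1.differentiable one_ne_zero w) (k1.differentiable one_ne_zero w), a1]
      congr 1
      · by_cases hw : δ ≤ ‖w - z‖
        · simp [kP_zero hδ hw]
        · rw [η2 w, one_mul]
          rw [mem_ball, dist_eq_norm] at hz
          rw [mem_closedBall, dist_eq_norm]
          have h2 : ‖w - x‖ ≤ ‖w - z‖ + ‖z - x‖ := by
            have := norm_add_le (w - z) (z - x); simpa using this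
          linarith
      · by_cases hw : dbar η w = 0
        · simp [hw]
        · have := (hfar z hz w hw).2
          rw [kK_eq hδ (by linarith), kK_eq hr (by linarith), mul_comm]
    have e1 := htest χ hT
    have i1 : Integrable (fun w => v w * (kP δ (w - z) : ℂ)) :=
      (kP_integrable hδ z).bdd_mul hv.aestronglyMeasurable (Filter.Eventually.of_forall hV)
    have e2 : (∫ w, v w * kP δ (w - z)) - S z = ∫ y, χ y * b y ∂μ := by
      rw [← e1, hS, sub_neg_eq_add, ← integral_add i1 (hker z)]
      congr 1; ext w
      rw [hdχ]; ring
    rw [e2]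
    refine (enorm_integral_le_lintegral_enorm _).trans ?_
    rw [hG]
    beta_reduce
    rw [← lintegral_indicator isClosed_closedBall.measurableSet]
    refine lintegral_mono fun y => ?_
    by_cases hy : y ∈ closedBall x (2 * (N * r))
    · rw [Set.indicator_of_mem hy, enorm_mul, mul_comm]
      gcongr
      rw [← ofReal_norm]
      apply ENNReal.ofReal_le_ofReal
      rw [hχ, norm_mul]
      calc _ ≤ 1 * ‖y - z‖⁻¹ := mul_le_mul (η4 y) (norm_kK_le _ _) (norm_nonneg _) zero_le_one
        _ = _ := one_mul _
    · have : χ y = 0 := image_eq_zero_of_notMem_tsupport fun h => hy (hT.2.2 h)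
      simp [this]
  have step2 : ∀ᵐ z, z ∈ ball x (3 * r) → ‖π * v z - S z‖ₑ ≤ G z := by
    filter_upwards [kP_limit hv hV] with z hz hzb
    have h1 := (hz.sub_const (S z)).enorm
    refine le_of_tendsto h1 ?_
    filter_upwards [Ioo_mem_nhdsGT hr] with δ hδ
    exact step1 z hzb δ hδ.1 hδ.2
  have step3 : ∀ z ∈ ball x (3 * r), ‖S z - S x‖ₑ ≤ ENNReal.ofReal (24 * π * C * V / N) := by
    intro z hz
    have hx : x ∈ ball x (3 * r) := mem_ball_self (by positivity)
    have e1 : S z - S x = ∫ w, v w * (dbar η w * (kK r (w - x) - kK r (w - z))) := by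
      rw [hS]
      simp only [neg_sub_neg]
      rw [← integral_sub (hker x) (hker z)]
      congr 1; ext w; ring
    rw [e1]
    refine (enorm_integral_le_lintegral_enorm _).trans ?_
    refine (lintegral_le_of_support (x := x) (s := 2 * (N * r)) (c := V * (C / (N * r) * (6 / (N ^ 2 * r))))
      (by positivity) (by positivity) ?_ ?_).trans ?_
    · intro w hw
      simp [hd1 w hw]
    · intro w _
      rw [← ofReal_norm]
      apply ENNReal.ofReal_le_ofReal
      rw [norm_mul, norm_mul]
      refine mul_le_mul (hV w) ?_ (by positivity) hV0
      by_cases hw : dbar η w = 0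
      · rw [hw, norm_zero, zero_mul]; positivity
      · refine mul_le_mul (hdb w) ?_ (by positivity) (by positivity)
        obtain ⟨f1, f2⟩ := hfar z hz w hw
        rw [kK_eq hr (by linarith), kK_eq hr (by linarith)]
        have n1 : w - x ≠ 0 := norm_pos_iff.1 (by linarith)
        have n2 : w - z ≠ 0 := norm_pos_iff.1 (by linarith)
        rw [inv_sub_inv n1 n2, norm_div, norm_mul]
        have : ‖w - z - (w - x)‖ ≤ 3 * r := by
          rw [mem_ball, dist_eq_norm] at hz
          rw [show w - z - (w - x) = -(z - x) by ring, norm_neg]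
          exact hz.le
        calc _ ≤ 3 * r / (N * r * (N * r / 2)) := by gcongr
          _ = _ := by field_simp; ring
    · apply ENNReal.ofReal_le_ofReal
      apply le_of_eq
      field_simp; ring
  refine ⟨S x / π, ?_⟩
  have hpi : (1:ℝ) ≤ π := by linarith [pi_gt_three]
  have step4 : ∀ᵐ z, z ∈ ball x (3 * r) → ‖v z - S x / π‖ₑ ≤ G z + ENNReal.ofReal (24 * π * C * V / N) := by
    filter_upwards [step2] with z hz hzb
    have h1 : ‖v z - S x / π‖ₑ ≤ ‖π * v z - S x‖ₑ := by
      rw [← ofReal_norm, ← ofReal_norm]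
      apply ENNReal.ofReal_le_ofReal
      have hpc : (π : ℂ) ≠ 0 := by exact_mod_cast pi_ne_zero
      rw [show π * v z - S x = π * (v z - S x / π) by field_simp, norm_mul, Complex.norm_real,
        Real.norm_eq_abs, abs_of_pos pi_pos]
      exact le_mul_of_one_le_left (norm_nonneg _) hpi
    refine h1.trans ?_
    rw [show π * v z - S x = (π * v z - S z) + (S z - S x) by ring]
    exact (enorm_add_le _ _).trans (add_le_add (hz hzb) (step3 z hzb))
  have hGint : ∫⁻ z in ball x (3 * r), G z ≤ ENNReal.ofReal (9 * π * r) * ENNReal.ofReal e := by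
    rw [hG]
    rw [lintegral_lintegral_swap]
    · calc _ ≤ ∫⁻ y in closedBall x (2 * (N * r)), ENNReal.ofReal (9 * π * r) * ‖b y‖ₑ ∂μ := by
            refine lintegral_mono fun y => ?_
            have hm : Measurable (fun z : ℂ => ENNReal.ofReal ‖y - z‖⁻¹) := by fun_prop
            simp only
            rw [lintegral_const_mul _ hm, mul_comm]
            gcongr
            refine (lintegral_inv_ball_any y x (by positivity)).trans (le_of_eq ?_)
            congr 1; ring
        _ = ENNReal.ofReal (9 * π * r) * ∫⁻ y in closedBall x (2 * (N * r)), ‖b y‖ₑ ∂μ :=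
            lintegral_const_mul'' _ hb.aestronglyMeasurable.enorm.restrict
        _ ≤ _ := mul_le_mul_right hbe _
    · change AEMeasurable (fun p : ℂ × ℂ => ‖b p.2‖ₑ * ENNReal.ofReal ‖p.2 - p.1‖⁻¹) _
      have h1 : AEMeasurable (fun y => ‖b y‖ₑ) (μ.restrict (closedBall x (2 * (N * r)))) :=
        hb.aestronglyMeasurable.enorm.restrict
      have h2 : Measurable (fun p : ℂ × ℂ => ENNReal.ofReal ‖p.2 - p.1‖⁻¹) := by fun_prop
      exact h1.comp_snd.mul h2.aemeasurable
  calc ∫⁻ z in ball x (3 * r), ‖v z - S x / π‖ₑ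
      ≤ ∫⁻ z in ball x (3 * r), (G z + ENNReal.ofReal (24 * π * C * V / N)) := by
        refine lintegral_mono_ae ?_
        rw [ae_restrict_iff' measurableSet_ball]
        exact step4
    _ = (∫⁻ z in ball x (3 * r), G z) + ENNReal.ofReal (24 * π * C * V / N) * volume (ball x (3 * r)) := by
        rw [lintegral_add_right _ measurable_const, setLIntegral_const]
    _ ≤ ENNReal.ofReal (9 * π * r) * ENNReal.ofReal e +
        ENNReal.ofReal (24 * π * C * V / N) * ENNReal.ofReal (9 * π * r ^ 2) := by
        gcongr
        rw [Complex.volume_ball, ← ENNReal.ofReal_pow (by positivity)]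
        have : (NNReal.pi : ℝ≥0∞) = ENNReal.ofReal π := by
          rw [← NNReal.coe_real_pi, ENNReal.ofReal_coe_nnreal]
        rw [this, ← ENNReal.ofReal_mul (by positivity)]
        apply le_of_eq; congr 1; ring
    _ ≤ _ := by
        rw [← ENNReal.ofReal_mul (by positivity), ← ENNReal.ofReal_mul (by positivity),
          ← ENNReal.ofReal_add (by positivity) (by positivity)]
        apply ENNReal.ofReal_le_ofReal
        have p1 : 0 ≤ r ^ 2 * V / N * π := by positivity
        have p2 : 0 ≤ C * (r * e) * π ^ 2 := by positivity
        have : 24 * π * C * V / N * (9 * π * r ^ 2) = 24 * π * C * (9 * π) * (r ^ 2 * V / N) := by ring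
        rw [this]
        nlinarith

end Cell


namespace Cell
open scoped ENNReal

/-- A one dimensional bump function. -/
noncomputable def bump (lo hi w t : ℝ) : ℝ :=
  smoothTransition ((t - lo) / w + 1) * smoothTransition ((hi - t) / w + 1)

lemma bump_contDiff (lo hi w : ℝ) : ContDiff ℝ 1 (bump lo hi w) := by
  unfold bump
  have h := smoothTransition.contDiff (n := 1)
  refine ContDiff.mul (h.comp ?_) (h.comp ?_)
  · fun_prop
  · fun_prop

lemma bump_nonneg (lo hi w t : ℝ) : 0 ≤ bump lo hi w t :=
  mul_nonneg (smoothTransition.nonneg _) (smoothTransition.nonneg _)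

lemma bump_le_one (lo hi w t : ℝ) : bump lo hi w t ≤ 1 :=
  mul_le_one₀ (smoothTransition.le_one _) (smoothTransition.nonneg _) (smoothTransition.le_one _)

lemma bump_one {lo hi w t : ℝ} (hw : 0 < w) (h1 : lo ≤ t) (h2 : t ≤ hi) : bump lo hi w t = 1 := by
  unfold bump
  have a1 : 0 ≤ (t - lo) / w := div_nonneg (by linarith) hw.le
  have a2 : 0 ≤ (hi - t) / w := div_nonneg (by linarith) hw.le
  rw [smoothTransition.one_of_one_le (by linarith), smoothTransition.one_of_one_le (by linarith), one_mul]

lemma bump_zero {lo hi w t : ℝ} (hw : 0 < w) (h : t ≤ lo - w ∨ hi + w ≤ t) : bump lo hi w t = 0 := by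
  unfold bump
  rcases h with h | h
  · have : (t - lo) / w ≤ -1 := by rw [div_le_iff₀ hw]; linarith
    rw [smoothTransition.zero_of_nonpos (x := (t - lo) / w + 1) (by linarith), zero_mul]
  · have : (hi - t) / w ≤ -1 := by rw [div_le_iff₀ hw]; linarith
    rw [smoothTransition.zero_of_nonpos (x := (hi - t) / w + 1) (by linarith), mul_zero]

lemma bump_deriv_le {lo hi w : ℝ} (hw : 0 < w) (t : ℝ) : |deriv (bump lo hi w) t| ≤
    w⁻¹ * (deriv smoothTransition ((t - lo) / w + 1) + deriv smoothTransition ((hi - t) / w + 1)) := by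
  have d1 : ∀ y, HasDerivAt smoothTransition (deriv smoothTransition y) y := fun y =>
    ((smoothTransition.contDiff (n := 1)).differentiable one_ne_zero _).hasDerivAt
  have a1 : HasDerivAt (fun t : ℝ => (t - lo) / w + 1) (1 / w) t :=
    (((hasDerivAt_id t).sub_const lo).div_const w).add_const 1
  have a2 : HasDerivAt (fun t : ℝ => (hi - t) / w + 1) (-1 / w) t :=
    (((hasDerivAt_id t).const_sub hi).div_const w).add_const 1
  have a3 : HasDerivAt (bump lo hi w) _ t := ((d1 _).comp t a1).mul ((d1 _).comp t a2)
  rw [a3.deriv]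
  simp only [Function.comp_apply]
  have n1 := st_deriv_nonneg ((t - lo) / w + 1)
  have n2 := st_deriv_nonneg ((hi - t) / w + 1)
  set p := deriv smoothTransition ((t - lo) / w + 1)
  set q := deriv smoothTransition ((hi - t) / w + 1)
  have s1 := smoothTransition.nonneg ((t - lo) / w + 1)
  have s2 := smoothTransition.nonneg ((hi - t) / w + 1)
  have s3 := smoothTransition.le_one ((t - lo) / w + 1)
  have s4 := smoothTransition.le_one ((hi - t) / w + 1)
  set c := smoothTransition ((t - lo) / w + 1)
  set d := smoothTransition ((hi - t) / w + 1)
  have e : p * (1 / w) * d + c * (q * (-1 / w)) = w⁻¹ * (p * d - c * q) := by field_simp; ring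
  rw [e, abs_mul, abs_of_pos (inv_pos.2 hw)]
  apply mul_le_mul_of_nonneg_left _ (inv_pos.2 hw).le
  have b1 : p * d ≤ p := mul_le_of_le_one_right n1 s4
  have b2 : c * q ≤ q := mul_le_of_le_one_left n2 s3
  have b3 : 0 ≤ p * d := by positivity
  have b4 : 0 ≤ c * q := by positivity
  rw [abs_le]; constructor <;> linarith

lemma st_compact : HasCompactSupport (deriv smoothTransition) := by
  refine HasCompactSupport.intro (isCompact_Icc (a := (0:ℝ)) (b := 1)) ?_
  intro x hx
  apply st_deriv_zero
  simp only [Set.mem_Icc, not_and_or, not_le] at hx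
  exact hx.imp le_of_lt le_of_lt

lemma st_integrable : Integrable (deriv smoothTransition) :=
  continuous_st_deriv.integrable_of_hasCompactSupport st_compact

lemma st_integral : ∫ x, deriv smoothTransition x = 1 := by
  have := integral_of_hasDerivAt_of_tendsto (f := smoothTransition) (f' := deriv smoothTransition) (m := 0) (n := 1)
    (fun y => ((smoothTransition.contDiff (n := 1)).differentiable one_ne_zero _).hasDerivAt)
    st_integrable ?_ ?_
  · simpa using this
  · apply tendsto_const_nhds.congr'
    filter_upwards [Filter.eventually_le_atBot 0] with x hx
    rw [smoothTransition.zero_of_nonpos hx]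
  · apply tendsto_const_nhds.congr'
    filter_upwards [Filter.eventually_ge_atTop 1] with x hx
    rw [smoothTransition.one_of_one_le hx]

lemma st_lintegral : ∫⁻ x, ENNReal.ofReal (deriv smoothTransition x) = 1 := by
  rw [← ofReal_integral_eq_lintegral_ofReal st_integrable (Filter.Eventually.of_forall st_deriv_nonneg),
    st_integral, ENNReal.ofReal_one]

lemma st_affine (a c : ℝ) (ha : a ≠ 0) :
    ∫ t, deriv smoothTransition (t / a + c) = |a| := by
  have h := Measure.integral_comp_div (fun y => deriv smoothTransition (y + c)) a
  rw [h, integral_add_right_eq_self (deriv smoothTransition), st_integral]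
  simp

lemma st_affine_int (a c : ℝ) (ha : a ≠ 0) : Integrable (fun t => deriv smoothTransition (t / a + c)) :=
  (st_integrable.comp_add_right c).comp_div ha

lemma bump_lintegral {lo hi w : ℝ} (hw : 0 < w) :
    ∫⁻ t, ENNReal.ofReal |deriv (bump lo hi w) t| ≤ 2 := by
  have e1 : ∀ t, (t - lo) / w + 1 = t / w + (1 - lo / w) := fun t => by field_simp; ring
  have e2 : ∀ t, (hi - t) / w + 1 = t / (-w) + (1 + hi / w) := fun t => by field_simp; ring
  have i1 := st_affine_int w (1 - lo / w) hw.ne'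
  have i2 := st_affine_int (-w) (1 + hi / w) (by linarith)
  calc _ ≤ ∫⁻ t, ENNReal.ofReal (w⁻¹ * (deriv smoothTransition (t / w + (1 - lo / w)) +
        deriv smoothTransition (t / (-w) + (1 + hi / w)))) := by
        refine lintegral_mono fun t => ENNReal.ofReal_le_ofReal ?_
        have := bump_deriv_le (lo := lo) (hi := hi) hw t
        rw [e1, e2] at this
        exact this
    _ = ENNReal.ofReal (∫ t, w⁻¹ * (deriv smoothTransition (t / w + (1 - lo / w)) +
        deriv smoothTransition (t / (-w) + (1 + hi / w)))) := by
        have i3 : Integrable (fun t => w⁻¹ * (deriv smoothTransition (t / w + (1 - lo / w)) +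
            deriv smoothTransition (t / (-w) + (1 + hi / w)))) := (i1.add i2).const_mul _
        rw [ofReal_integral_eq_lintegral_ofReal i3]
        refine Filter.Eventually.of_forall fun t => ?_
        have := st_deriv_nonneg (t / w + (1 - lo / w))
        have := st_deriv_nonneg (t / (-w) + (1 + hi / w))
        simp only [Pi.zero_apply]
        positivity
    _ = _ := by
        rw [integral_const_mul, integral_add i1 i2, st_affine _ _ hw.ne', st_affine _ _ (by linarith),
          abs_neg, abs_of_pos hw]
        rw [show w⁻¹ * (w + w) = 2 by field_simp; norm_num]
        simp

/-- Rotated coordinate. -/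
noncomputable def rot (ν x z : ℂ) : ℂ := (starRingEnd ℂ) ν * (z - x)

lemma rot_lintegral {ν x : ℂ} (hν : ‖ν‖ = 1) (f g : ℝ → ℝ≥0∞) (hf : Measurable f) (hg : Measurable g) :
    ∫⁻ z, f (rot ν x z).re * g (rot ν x z).im = (∫⁻ t, f t) * ∫⁻ t, g t := by
  have hν' : ‖(starRingEnd ℂ) ν‖ = 1 := by simpa using hν
  let c : Circle := ⟨(starRingEnd ℂ) ν, by simpa [Submonoid.unitSphere] using hν'⟩
  have h1 : ∫⁻ z, f (rot ν x z).re * g (rot ν x z).im = ∫⁻ z, f ((rotation c) z).re * g ((rotation c) z).im := by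
    rw [← lintegral_sub_right_eq_self (μ := (volume : Measure ℂ))
      (fun z => f ((rotation c) z).re * g ((rotation c) z).im) x]
    congr 1
  have hm : Measurable (fun z : ℂ => f z.re * g z.im) :=
    (hf.comp Complex.measurable_re).mul (hg.comp Complex.measurable_im)
  rw [h1, (rotation c).measurePreserving.lintegral_comp hm]
  have h2 := Complex.volume_preserving_equiv_real_prod.lintegral_comp
    (f := fun p : ℝ × ℝ => f p.1 * g p.2) ((hf.comp measurable_fst).mul (hg.comp measurable_snd))
  have h3 : (fun z : ℂ => f z.re * g z.im) = fun z =>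
    (fun p : ℝ × ℝ => f p.1 * g p.2) (Complex.measurableEquivRealProd z) := by
    ext z; simp
  rw [h3, h2, Measure.volume_eq_prod, lintegral_prod_mul hf.aemeasurable hg.aemeasurable]

lemma exists_test_fn : ∃ c : ℝ, 0 < c ∧ ∀ (x ν : ℂ) (r κ : ℝ) (S : Set ℂ), ‖ν‖ = 1 → 0 < r → 0 < κ → κ ≤ 1 →
    x ∈ S → Bornology.IsBounded S → diam S = r → ∃ χ : ℂ → ℝ, ContDiff ℝ 1 χ ∧
      (∀ z, z ∉ ball x (3 * r) → χ z = 0) ∧ HasCompactSupport χ ∧ tsupport χ ⊆ closedBall x (3 * r) ∧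
      (∀ z, 0 ≤ χ z) ∧ (∀ z, χ z ≤ 1) ∧ (∀ z ∈ S, χ z = 1) ∧ (∀ z, ‖fderiv ℝ χ z‖ ≤ c / (κ * r)) ∧
      ∫⁻ z, ‖fderiv ℝ χ z ν‖ₑ ≤ ENNReal.ofReal (2 * ((1 + 2 * κ) * r)) := by
  obtain ⟨C, hC, hst⟩ := exists_st_bound
  refine ⟨4 * C, by positivity, ?_⟩
  intro x ν r κ S hν hr hκ hκ1 hxS hSb hSd
  set lo : ℝ := sInf ((fun z => (rot ν x z).im) '' S) with hlo
  have hν' : ‖(starRingEnd ℂ) ν‖ = 1 := by simpa using hν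
  have hrot : ∀ z y, |(rot ν x z).im - (rot ν x y).im| ≤ ‖z - y‖ := by
    intro z y
    rw [← Complex.sub_im]
    refine (Complex.abs_im_le_norm _).trans (le_of_eq ?_)
    unfold rot
    rw [← mul_sub, norm_mul, hν', one_mul]; congr 1; ring
  have hdS : ∀ z ∈ S, ∀ y ∈ S, |(rot ν x z).im - (rot ν x y).im| ≤ r := by
    intro z hz y hy
    refine (hrot z y).trans ?_
    rw [← dist_eq_norm, ← hSd]
    exact dist_le_diam_of_mem hSb hz hy
  have hx0 : rot ν x x = 0 := by simp [rot]
  have hbdd : BddBelow ((fun z => (rot ν x z).im) '' S) := by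
    refine ⟨-r, ?_⟩
    rintro _ ⟨z, hz, rfl⟩
    have := hdS z hz x hxS
    rw [hx0, Complex.zero_im, sub_zero, abs_le] at this
    exact this.1
  have hlo1 : ∀ z ∈ S, lo ≤ (rot ν x z).im := fun z hz => csInf_le hbdd ⟨z, hz, rfl⟩
  have hlo2 : ∀ z ∈ S, (rot ν x z).im ≤ lo + r := by
    intro z hz
    have : (rot ν x z).im - r ≤ lo := by
      refine le_csInf (Set.Nonempty.image _ ⟨x, hxS⟩) ?_
      rintro _ ⟨y, hy, rfl⟩
      have := (abs_le.1 (hdS z hz y hy)).2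
      simp only
      linarith
    linarith
  have hlo0 : lo ≤ 0 := by have := hlo1 x hxS; simpa [hx0] using this
  have hlor : -r ≤ lo := by have := hlo2 x hxS; rw [hx0, Complex.zero_im] at this; linarith
  have hκr : 0 < κ * r := by positivity
  have hκr1 : κ * r ≤ r := mul_le_of_le_one_left hr.le hκ1
  set f := bump (-r) r r with hf
  set g := bump lo (lo + r) (κ * r) with hg
  set χ : ℂ → ℝ := fun z => f (rot ν x z).re * g (rot ν x z).im with hχ
  let Lr : ℂ →L[ℝ] ℂ := ContinuousLinearMap.restrictScalars ℝ (ContinuousLinearMap.toSpanSingleton ℂ ((starRingEnd ℂ) ν))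
  have hL : ∀ v, Lr v = (starRingEnd ℂ) ν * v := fun v => by simp [Lr, mul_comm]
  have hLd : ∀ z, HasFDerivAt (rot ν x) Lr z := by
    intro z
    have h1 := Lr.hasFDerivAt (x := z - x)
    have h2 := h1.comp z ((hasFDerivAt_id (𝕜 := ℝ) z).sub_const x)
    rw [ContinuousLinearMap.comp_id] at h2
    refine h2.congr_of_eventuallyEq (Filter.Eventually.of_forall fun w => ?_)
    simp [hL, rot]
  have hred : ∀ z, HasFDerivAt (fun z => (rot ν x z).re) (Complex.reCLM.comp Lr) z := fun z =>
    Complex.reCLM.hasFDerivAt.comp z (hLd z)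
  have himd : ∀ z, HasFDerivAt (fun z => (rot ν x z).im) (Complex.imCLM.comp Lr) z := fun z =>
    Complex.imCLM.hasFDerivAt.comp z (hLd z)
  have fd : ∀ t, HasDerivAt f (deriv f t) t := fun t =>
    ((bump_contDiff _ _ _).differentiable one_ne_zero t).hasDerivAt
  have gd : ∀ t, HasDerivAt g (deriv g t) t := fun t =>
    ((bump_contDiff _ _ _).differentiable one_ne_zero t).hasDerivAt
  have hd : ∀ z v, fderiv ℝ χ z v = f (rot ν x z).re * (deriv g (rot ν x z).im * ((starRingEnd ℂ) ν * v).im) +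
      g (rot ν x z).im * (deriv f (rot ν x z).re * ((starRingEnd ℂ) ν * v).re) := by
    intro z v
    have h1 := (fd (rot ν x z).re).comp_hasFDerivAt z (hred z)
    have h2 := (gd (rot ν x z).im).comp_hasFDerivAt z (himd z)
    have h3 : HasFDerivAt χ _ z := h1.mul h2
    rw [h3.fderiv]
    simp [hL]
  have hfb : ∀ t, |deriv f t| ≤ 2 * C / r := fun t => by
    refine (bump_deriv_le hr t).trans ?_
    have := hst ((t - -r) / r + 1)
    have := hst ((r - t) / r + 1)
    calc _ ≤ r⁻¹ * (C + C) := by gcongr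
      _ = _ := by ring
  have hgb : ∀ t, |deriv g t| ≤ 2 * C / (κ * r) := fun t => by
    refine (bump_deriv_le hκr t).trans ?_
    have := hst ((t - lo) / (κ * r) + 1)
    have := hst ((lo + r - t) / (κ * r) + 1)
    calc _ ≤ (κ * r)⁻¹ * (C + C) := by gcongr
      _ = _ := by ring
  have hf0 := bump_nonneg (-r) r r
  have hf1 := bump_le_one (-r) r r
  have hg0 := bump_nonneg lo (lo + r) (κ * r)
  have hg1 := bump_le_one lo (lo + r) (κ * r)
  have hsup : ∀ z, z ∉ ball x (3 * r) → χ z = 0 := by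
    intro z hz
    by_contra hne
    apply hz
    have h1 : f (rot ν x z).re ≠ 0 := left_ne_zero_of_mul hne
    have h2 : g (rot ν x z).im ≠ 0 := right_ne_zero_of_mul hne
    have h3 : ¬ ((rot ν x z).re ≤ -r - r ∨ r + r ≤ (rot ν x z).re) := fun h => h1 (bump_zero hr h)
    have h4 : ¬ ((rot ν x z).im ≤ lo - κ * r ∨ lo + r + κ * r ≤ (rot ν x z).im) := fun h => h2 (bump_zero hκr h)
    push Not at h3 h4
    rw [mem_ball, dist_eq_norm]
    have h5 : ‖z - x‖ = ‖rot ν x z‖ := by rw [rot, norm_mul, hν', one_mul]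
    rw [h5]
    have h6 : ‖rot ν x z‖ ^ 2 = (rot ν x z).re ^ 2 + (rot ν x z).im ^ 2 := by
      rw [← Complex.normSq_eq_norm_sq, Complex.normSq_apply]; ring
    have h7 : (rot ν x z).re ^ 2 ≤ (2 * r) ^ 2 := by
      apply sq_le_sq'; all_goals linarith [h3.1, h3.2]
    have h8 : (rot ν x z).im ^ 2 ≤ (2 * r) ^ 2 := by
      apply sq_le_sq'; all_goals linarith [h4.1, h4.2]
    apply lt_of_pow_lt_pow_left₀ 2 (by positivity)
    rw [h6]
    nlinarith [sq_pos_of_pos hr]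
  refine ⟨χ, ?_, hsup, ?_, ?_, ?_, ?_, ?_, ?_, ?_⟩
  · have r1 : ContDiff ℝ 1 (fun z => (rot ν x z).re) := by
      have r0 : ContDiff ℝ 1 (rot ν x) := by unfold rot; fun_prop
      exact Complex.reCLM.contDiff.comp r0
    have r2 : ContDiff ℝ 1 (fun z => (rot ν x z).im) := by
      have r0 : ContDiff ℝ 1 (rot ν x) := by unfold rot; fun_prop
      exact Complex.imCLM.contDiff.comp r0
    exact ((bump_contDiff _ _ _).comp r1).mul ((bump_contDiff _ _ _).comp r2)
  · exact HasCompactSupport.intro (isCompact_closedBall x (3 * r)) fun z hz =>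
      hsup z fun h => hz (ball_subset_closedBall h)
  · apply closure_minimal _ isClosed_closedBall
    intro z hz
    by_contra h
    exact hz (hsup z fun h' => h (ball_subset_closedBall h'))
  · exact fun z => mul_nonneg (hf0 _) (hg0 _)
  · exact fun z => mul_le_one₀ (hf1 _) (hg0 _) (hg1 _)
  · intro z hz
    have h1 : |(rot ν x z).re| ≤ r := by
      refine (Complex.abs_re_le_norm _).trans ?_
      rw [rot, norm_mul, hν', one_mul, ← dist_eq_norm, ← hSd]
      exact dist_le_diam_of_mem hSb hz hxS
    rw [abs_le] at h1
    simp only [hχ, hf, hg]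
    rw [bump_one hr h1.1 h1.2, bump_one hκr (hlo1 z hz) (hlo2 z hz), one_mul]
  · intro z
    apply ContinuousLinearMap.opNorm_le_bound _ (by positivity)
    intro v
    rw [hd, Real.norm_eq_abs]
    have n1 : |((starRingEnd ℂ) ν * v).im| ≤ ‖v‖ := by
      refine (Complex.abs_im_le_norm _).trans ?_; rw [norm_mul, hν', one_mul]
    have n2 : |((starRingEnd ℂ) ν * v).re| ≤ ‖v‖ := by
      refine (Complex.abs_re_le_norm _).trans ?_; rw [norm_mul, hν', one_mul]
    have b1 : 2 * C / r ≤ 2 * C / (κ * r) := by gcongr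
    refine (abs_add_le _ _).trans ?_
    rw [abs_mul, abs_mul, abs_mul, abs_mul, abs_of_nonneg (hf0 _), abs_of_nonneg (hg0 _)]
    have c1 : f (rot ν x z).re * (|deriv g (rot ν x z).im| * |((starRingEnd ℂ) ν * v).im|) ≤
        1 * (2 * C / (κ * r) * ‖v‖) := by
      refine mul_le_mul (hf1 _) (mul_le_mul (hgb _) n1 (abs_nonneg _) (by positivity)) (by positivity) zero_le_one
    have c2 : g (rot ν x z).im * (|deriv f (rot ν x z).re| * |((starRingEnd ℂ) ν * v).re|) ≤
        1 * (2 * C / (κ * r) * ‖v‖) := by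
      refine mul_le_mul (hg1 _) (mul_le_mul ((hfb _).trans b1) n2 (abs_nonneg _) (by positivity)) (by positivity) zero_le_one
    calc _ ≤ 1 * (2 * C / (κ * r) * ‖v‖) + 1 * (2 * C / (κ * r) * ‖v‖) := add_le_add c1 c2
      _ = _ := by ring
  · have hνν : (starRingEnd ℂ) ν * ν = 1 := by
      rw [mul_comm, Complex.mul_conj, Complex.normSq_eq_norm_sq, hν]; simp
    have e1 : ∀ z, ‖fderiv ℝ χ z ν‖ₑ ≤ ENNReal.ofReal |deriv f (rot ν x z).re| *
        (Set.Icc (lo - κ * r) (lo + r + κ * r)).indicator 1 (rot ν x z).im := by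
      intro z
      rw [hd, hνν]
      simp only [Complex.one_im, Complex.one_re, mul_zero, mul_one, zero_add]
      by_cases h : (rot ν x z).im ∈ Set.Icc (lo - κ * r) (lo + r + κ * r)
      · rw [Set.indicator_of_mem h, Pi.one_apply, mul_one, ← ofReal_norm, Real.norm_eq_abs, abs_mul,
          abs_of_nonneg (hg0 _)]
        exact ENNReal.ofReal_le_ofReal (mul_le_of_le_one_left (abs_nonneg _) (hg1 _))
      · have : g (rot ν x z).im = 0 := by
          apply bump_zero hκr
          simp only [Set.mem_Icc, not_and_or, not_le] at h
          exact h.imp le_of_lt le_of_lt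
        rw [this]; simp
    refine (lintegral_mono e1).trans ?_
    have hdc : Continuous (deriv f) := (bump_contDiff _ _ _).continuous_deriv le_rfl
    have hfm : Measurable (fun t => ENNReal.ofReal |deriv f t|) := by
      have := hdc.measurable
      fun_prop
    rw [rot_lintegral hν _ _ hfm (measurable_one.indicator measurableSet_Icc),
      lintegral_indicator_one measurableSet_Icc, Real.volume_Icc]
    calc _ ≤ 2 * ENNReal.ofReal (lo + r + κ * r - (lo - κ * r)) := by
          gcongr; exact bump_lintegral hr
      _ ≤ _ := by
          rw [show (2:ℝ≥0∞) = ENNReal.ofReal 2 by simp, ← ENNReal.ofReal_mul (by norm_num)]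
          apply ENNReal.ofReal_le_ofReal
          linarith

end Cell


namespace Cell
open scoped ENNReal

lemma exists_phase (s : ℂ) : ∃ ω : ℂ, ‖ω‖ = 1 ∧ s = ‖s‖ * ω := by
  by_cases h : s = 0
  · exact ⟨1, by simp, by simp [h]⟩
  · have h' : (‖s‖ : ℂ) ≠ 0 := by simpa using h
    refine ⟨s / ‖s‖, ?_, ?_⟩
    · rw [norm_div]; simp [h]
    · field_simp

lemma conj_mul_self {ω : ℂ} (h : ‖ω‖ = 1) : (starRingEnd ℂ) ω * ω = 1 := by
  rw [Complex.conj_mul', h]; simp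

lemma im_sq_le {ω s y : ℂ} (h : ‖ω‖ = 1) (hs : s = ‖s‖ * ω) :
    ((starRingEnd ℂ) ω * y).im ^ 2 ≤ ‖y ^ 2 - s ^ 2‖ := by
  set q := (starRingEnd ℂ) ω * y with hq
  have hy : y = ω * q := by
    rw [hq, ← mul_assoc, mul_comm ω, conj_mul_self h, one_mul]
  have e : y ^ 2 - s ^ 2 = ω ^ 2 * ((q - ‖s‖) * (q + ‖s‖)) := by
    rw [hy]
    conv_lhs => rw [hs]
    ring
  rw [e, norm_mul, norm_pow, h, one_pow, one_mul, norm_mul, ← sq_abs, sq]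
  have h1 : |q.im| ≤ ‖q - ‖s‖‖ := by simpa using Complex.abs_im_le_norm (q - (‖s‖ : ℂ))
  have h2 : |q.im| ≤ ‖q + ‖s‖‖ := by simpa using Complex.abs_im_le_norm (q + (‖s‖ : ℂ))
  gcongr

lemma near_line {μ : Measure ℂ} [IsFiniteMeasure μ] {u b b2 : ℂ → ℂ} {U : Set ℂ} {M R : ℝ} {x : ℂ}
    (hR : 0 < R) (hRU : closedBall x R ⊆ U) (hum : Measurable u) (huM : ∀ z, ‖u z‖ ≤ M)
    (hb : Integrable b μ) (hb2 : Integrable b2 μ)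
    (ht : ∀ χ, Test U χ → ∫ z, u z * dbar χ z = ∫ z, χ z * b z ∂μ)
    (ht2 : ∀ χ, Test U χ → ∫ z, u z ^ 2 * dbar χ z = ∫ z, χ z * b2 z ∂μ)
    (hl : ∀ τ > 0, ∃ r0 > 0, ∀ r, 0 < r → r < r0 →
      ∫⁻ y in closedBall x r, ‖b y - b x‖ₑ ∂μ ≤ ENNReal.ofReal (τ * r))
    (hl2 : ∀ τ > 0, ∃ r0 > 0, ∀ r, 0 < r → r < r0 →
      ∫⁻ y in closedBall x r, ‖b2 y - b2 x‖ₑ ∂μ ≤ ENNReal.ofReal (τ * r))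
    (hbx : b x ≠ 0) {κ : ℝ} (hκ : 0 < κ) :
    ∃ r1 > 0, ∀ r, 0 < r → r < r1 → ∃ ω m : ℂ, ‖ω‖ = 1 ∧
      ∫⁻ z in ball x (3 * r), ‖((starRingEnd ℂ) ω * (u z - m)).im‖ₑ ≤ ENNReal.ofReal (κ * r ^ 2) := by
  obtain ⟨c, hc, hnc⟩ := near_const
  have hM0 : 0 ≤ M := (norm_nonneg _).trans (huM 0)
  set l : ℂ := b2 x / b x with hldef
  have hlb : b2 x = l * b x := by rw [hldef]; field_simp
  set V : ℝ := M ^ 2 + ‖l‖ * M with hV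
  have hV0 : 0 ≤ V := by positivity
  set κ' : ℝ := κ / (2 * (9 * π)) with hκ'
  have hκ'0 : 0 < κ' := by positivity
  set ε : ℝ := κ * κ' / 2 with hε
  have hε0 : 0 < ε := by positivity
  set N : ℝ := 6 + 2 * c * V / ε with hN
  have hN6 : 6 ≤ N := by rw [hN]; have : 0 ≤ 2 * c * V / ε := by positivity
                         linarith
  have hN0 : 0 < N := by linarith
  set τ : ℝ := ε / (4 * c * N * (1 + ‖l‖)) with hτ
  have hτ0 : 0 < τ := by positivity
  obtain ⟨s1, hs1, hs1'⟩ := hl τ hτ0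
  obtain ⟨s2, hs2, hs2'⟩ := hl2 τ hτ0
  refine ⟨min R (min s1 s2) / (2 * N), by positivity, ?_⟩
  intro r hr hr1
  rw [lt_div_iff₀ (by positivity)] at hr1
  have hr2 : 2 * (N * r) < min R (min s1 s2) := by linarith
  rw [lt_min_iff, lt_min_iff] at hr2
  have hNr : 0 < 2 * (N * r) := by positivity
  have humm : Measurable (fun z => u z ^ 2 - l * u z) := by fun_prop
  obtain ⟨k, hk⟩ := hnc μ (fun z => u z ^ 2 - l * u z) (fun z => b2 z - l * b z) V
    (τ * (2 * (N * r)) * (1 + ‖l‖)) N r x humm (by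
      intro z
      refine (norm_sub_le _ _).trans ?_
      rw [norm_pow, norm_mul, hV]
      have := huM z
      gcongr) hN6 hr (by positivity) (hb2.sub (hb.const_mul l)) (by
      intro χ hχ
      have hχU : Test U χ := hχ.mono ((closedBall_subset_closedBall hr2.1.le).trans hRU)
      have i1 := integrable_bdd_dbar hum huM hχ.1 hχ.2.1
      have i2 := integrable_bdd_dbar (u := fun z => u z ^ 2) (M := M ^ 2) (by fun_prop) (fun z => by
        rw [norm_pow]; have := huM z; gcongr) hχ.1 hχ.2.1
      obtain ⟨D, hD⟩ := hχ.1.continuous.bounded_above_of_compact_support hχ.2.1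
      have i3 : Integrable (fun z => χ z * b z) μ :=
        hb.bdd_mul hχ.1.continuous.aestronglyMeasurable (Filter.Eventually.of_forall hD)
      have i4 : Integrable (fun z => χ z * b2 z) μ :=
        hb2.bdd_mul hχ.1.continuous.aestronglyMeasurable (Filter.Eventually.of_forall hD)
      have e1 : ∀ z, (u z ^ 2 - l * u z) * dbar χ z = u z ^ 2 * dbar χ z - l * (u z * dbar χ z) :=
        fun z => by ring
      have e2 : ∀ z, χ z * (b2 z - l * b z) = χ z * b2 z - l * (χ z * b z) := fun z => by ring
      simp_rw [e1, e2]
      rw [integral_sub i2 (i1.const_mul l), integral_sub i4 (i3.const_mul l), integral_const_mul,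
        integral_const_mul, ht χ hχU, ht2 χ hχU]) (by
      have m1 : AEMeasurable (fun y => ‖b2 y - b2 x‖ₑ) (μ.restrict (closedBall x (2 * (N * r)))) :=
        ((hb2.aestronglyMeasurable.sub aestronglyMeasurable_const).enorm).restrict
      calc ∫⁻ y in closedBall x (2 * (N * r)), ‖b2 y - l * b y‖ₑ ∂μ
          ≤ ∫⁻ y in closedBall x (2 * (N * r)), (‖b2 y - b2 x‖ₑ + ‖l‖ₑ * ‖b y - b x‖ₑ) ∂μ := by
            refine lintegral_mono fun y => ?_
            have : b2 y - l * b y = (b2 y - b2 x) - l * (b y - b x) := by rw [hlb]; ring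
            rw [this, ← enorm_mul]
            exact enorm_sub_le
        _ = _ := by rw [lintegral_add_left' m1, lintegral_const_mul' _ _ enorm_ne_top]
        _ ≤ ENNReal.ofReal (τ * (2 * (N * r))) + ‖l‖ₑ * ENNReal.ofReal (τ * (2 * (N * r))) := by
            gcongr
            · exact hs2' _ hNr hr2.2.2
            · exact hs1' _ hNr hr2.2.1
        _ = _ := by
            rw [← ofReal_norm, ← ENNReal.ofReal_mul (norm_nonneg _), ← ENNReal.ofReal_add (by positivity)
              (by positivity)]
            congr 1; ring)
  obtain ⟨s, hs⟩ := IsAlgClosed.exists_pow_nat_eq (k + l ^ 2 / 4) (n := 2) (by norm_num)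
  obtain ⟨ω, hω, hsω⟩ := exists_phase s
  refine ⟨ω, l / 2, hω, ?_⟩
  have hpt : ∀ z, ‖((starRingEnd ℂ) ω * (u z - l / 2)).im‖ₑ ≤
      ENNReal.ofReal κ' + ENNReal.ofReal κ'⁻¹ * ‖u z ^ 2 - l * u z - k‖ₑ := by
    intro z
    have h1 := im_sq_le (y := u z - l / 2) hω hsω
    rw [hs, show (u z - l / 2) ^ 2 - (k + l ^ 2 / 4) = u z ^ 2 - l * u z - k by ring] at h1
    rw [← ofReal_norm, ← ofReal_norm, ← ENNReal.ofReal_mul (by positivity), ← ENNReal.ofReal_add (by positivity)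
      (by positivity)]
    apply ENNReal.ofReal_le_ofReal
    rw [Real.norm_eq_abs]
    set Q := ((starRingEnd ℂ) ω * (u z - l / 2)).im
    have h2 : κ'⁻¹ * Q ^ 2 ≤ κ'⁻¹ * ‖u z ^ 2 - l * u z - k‖ := by gcongr
    refine le_trans ?_ (by gcongr : κ' + κ'⁻¹ * Q ^ 2 ≤ _)
    have h3 : κ' + κ'⁻¹ * Q ^ 2 = (κ' ^ 2 + Q ^ 2) / κ' := by field_simp
    rw [h3, le_div_iff₀ hκ'0, ← sq_abs Q]
    nlinarith [sq_nonneg (κ' - |Q|), sq_nonneg (κ' + |Q|), abs_nonneg Q]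
  calc _ ≤ ∫⁻ z in ball x (3 * r), (ENNReal.ofReal κ' + ENNReal.ofReal κ'⁻¹ * ‖u z ^ 2 - l * u z - k‖ₑ) :=
        lintegral_mono fun z => hpt z
    _ = ENNReal.ofReal κ' * volume (ball x (3 * r)) +
          ENNReal.ofReal κ'⁻¹ * ∫⁻ z in ball x (3 * r), ‖u z ^ 2 - l * u z - k‖ₑ := by
        rw [lintegral_add_left (by fun_prop), lintegral_const_mul' _ _ ENNReal.ofReal_ne_top]
        simp
    _ ≤ ENNReal.ofReal κ' * ENNReal.ofReal (9 * π * r ^ 2) + ENNReal.ofReal κ'⁻¹ *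
          ENNReal.ofReal (c * (r * (τ * (2 * (N * r)) * (1 + ‖l‖)) + r ^ 2 * V / N)) := by
        gcongr
        rw [Complex.volume_ball, ← ENNReal.ofReal_pow (by positivity), ← ENNReal.ofReal_coe_nnreal,
          NNReal.coe_real_pi, ← ENNReal.ofReal_mul (by positivity)]
        apply ENNReal.ofReal_le_ofReal
        apply le_of_eq; ring
    _ ≤ _ := by
        rw [← ENNReal.ofReal_mul (by positivity), ← ENNReal.ofReal_mul (by positivity),
          ← ENNReal.ofReal_add (by positivity) (by positivity)]
        apply ENNReal.ofReal_le_ofReal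
        have f1 : κ' * (9 * π * r ^ 2) = κ / 2 * r ^ 2 := by rw [hκ']; field_simp
        have f2 : c * (r * (τ * (2 * (N * r)) * (1 + ‖l‖))) = ε / 2 * r ^ 2 := by
          rw [hτ]; field_simp; norm_num
        have f3 : c * (V / N) ≤ ε / 2 := by
          rw [← mul_div_assoc, div_le_iff₀ hN0, hN]
          have : ε / 2 * (6 + 2 * c * V / ε) = 3 * ε + c * V := by field_simp; ring
          rw [this]; linarith
        have f4 : c * (r ^ 2 * V / N) ≤ ε / 2 * r ^ 2 := by
          have := mul_le_mul_of_nonneg_right f3 (sq_nonneg r)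
          calc _ = c * (V / N) * r ^ 2 := by ring
            _ ≤ _ := this
        have f5 : c * (r * (τ * (2 * (N * r)) * (1 + ‖l‖)) + r ^ 2 * V / N) ≤ ε * r ^ 2 := by
          rw [mul_add, f2]; linarith
        have f6 : κ'⁻¹ * (ε * r ^ 2) = κ / 2 * r ^ 2 := by rw [hε]; field_simp
        have f7 := mul_le_mul_of_nonneg_left f5 (inv_pos.2 hκ'0).le
        rw [f1]; linarith

end Cell


namespace Cell
open scoped ENNReal

lemma fderiv_coe {χ : ℂ → ℝ} (h : ContDiff ℝ 1 χ) (z v : ℂ) :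
    fderiv ℝ (fun w => (χ w : ℂ)) z v = ((fderiv ℝ χ z v : ℝ) : ℂ) := by
  have h1 := (h.differentiable one_ne_zero z).hasFDerivAt
  have h2 := (Complex.ofRealCLM.hasFDerivAt (x := χ z)).comp z h1
  have h3 : HasFDerivAt (fun w => (χ w : ℂ)) (Complex.ofRealCLM.comp (fderiv ℝ χ z)) z := h2
  rw [h3.fderiv]; simp

lemma dbar_coe {χ : ℂ → ℝ} (h : ContDiff ℝ 1 χ) (z : ℂ) :
    dbar (fun w => (χ w : ℂ)) z = ((fderiv ℝ χ z 1 : ℝ) + Complex.I * (fderiv ℝ χ z Complex.I : ℝ)) / 2 := by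
  unfold dbar; rw [fderiv_coe h, fderiv_coe h]

lemma re_mul_dbar {χ : ℂ → ℝ} (h : ContDiff ℝ 1 χ) (z γ : ℂ) :
    (γ * dbar (fun w => (χ w : ℂ)) z).re = 1 / 2 * fderiv ℝ χ z ((starRingEnd ℂ) γ) := by
  have e : (starRingEnd ℂ) γ = γ.re • (1 : ℂ) - γ.im • Complex.I := by
    apply Complex.ext <;> simp
  rw [dbar_coe h, e, map_sub, map_smul, map_smul]
  set p := fderiv ℝ χ z 1
  set q := fderiv ℝ χ z Complex.I
  have : γ * ((p + Complex.I * q) / 2) = (1 / 2 : ℝ) * (γ * (p + Complex.I * q)) := by push_cast; ring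
  rw [this, Complex.re_ofReal_mul]
  simp

lemma norm_dbar_coe {χ : ℂ → ℝ} (h : ContDiff ℝ 1 χ) (z : ℂ) :
    ‖dbar (fun w => (χ w : ℂ)) z‖ ≤ ‖fderiv ℝ χ z‖ := by
  rw [dbar_coe h, norm_div]
  have h1 : ‖fderiv ℝ χ z 1‖ ≤ ‖fderiv ℝ χ z‖ := by
    simpa using (fderiv ℝ χ z).le_opNorm 1
  have h2 : ‖fderiv ℝ χ z Complex.I‖ ≤ ‖fderiv ℝ χ z‖ := by
    simpa using (fderiv ℝ χ z).le_opNorm Complex.I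
  have h3 := norm_add_le ((fderiv ℝ χ z 1 : ℝ) : ℂ) (Complex.I * (fderiv ℝ χ z Complex.I : ℝ))
  rw [norm_mul, Complex.norm_I, one_mul, Complex.norm_real, Complex.norm_real] at h3
  rw [Complex.norm_ofNat, div_le_iff₀ (by norm_num)]
  linarith

lemma step_bound : ∃ c : ℝ, 0 < c ∧ ∀ {μ : Measure ℂ} [IsFiniteMeasure μ] {u b : ℂ → ℂ} {U S : Set ℂ}
    {M r κ ε η τ : ℝ} {x ω m : ℂ}, Measurable u → (∀ z, ‖u z‖ ≤ M) → Integrable b μ →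
    (∀ χ, Test U χ → ∫ z, u z * dbar χ z = ∫ z, χ z * b z ∂μ) →
    closedBall x (3 * r) ⊆ U → ‖ω‖ = 1 → 0 < r → 0 < η → η ≤ 1 → 0 < κ → 0 < τ →
    (∫⁻ z in ball x (3 * r), ‖((starRingEnd ℂ) ω * (u z - m)).im‖ₑ ≤ ENNReal.ofReal (κ * r ^ 2)) →
    x ∈ S → Bornology.IsBounded S → diam S = r → ENNReal.ofReal ((1 - ε) * r) ≤ μ S →
    (∫⁻ y in closedBall x (3 * r), ‖b y - b x‖ₑ ∂μ ≤ ENNReal.ofReal (τ * (3 * r))) →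
    ‖b x‖ * (1 - ε) ≤ M * (1 + 2 * η) + c * κ / η + 3 * τ := by
  obtain ⟨c, hc, hfn⟩ := exists_test_fn
  refine ⟨c, hc, ?_⟩
  intro μ _ u b U S M r κ ε η τ x ω m hum huM hb ht hU hω hr hη hη1 hκ hτ hq hxS hSb hSd hSμ hbl
  have hM0 : 0 ≤ M := (norm_nonneg _).trans (huM 0)
  obtain ⟨ωb, hωb, hβ⟩ := exists_phase (b x)
  set γ : ℂ := (starRingEnd ℂ) ωb * ω with hγ
  have hν : ‖(starRingEnd ℂ) γ‖ = 1 := by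
    rw [RCLike.norm_conj, hγ, norm_mul, RCLike.norm_conj, hωb, hω, one_mul]
  obtain ⟨χ, c1, c2, c3, c4, c5, c6, c7, c8, c9⟩ := hfn x ((starRingEnd ℂ) γ) r η S hν hr hη hη1 hxS hSb hSd
  set X : ℂ → ℂ := fun z => (χ z : ℂ) with hX
  have hX1 : ContDiff ℝ 1 X := Complex.ofRealCLM.contDiff.comp c1
  have hXs : tsupport X ⊆ tsupport χ := by
    apply closure_mono
    intro z hz hz'
    apply hz
    simp [hX, hz']
  have hX2 : HasCompactSupport X := c3.comp_left (g := fun t : ℝ => (t : ℂ)) (by simp)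
  have hXT : Test U X := ⟨hX1, hX2, (hXs.trans c4).trans hU⟩
  have hJ := ht X hXT
  -- upper bound
  set q : ℂ → ℝ := fun z => ((starRingEnd ℂ) ω * (u z - m)).im with hqdef
  set P : ℂ → ℝ := fun z => ((starRingEnd ℂ) ω * u z).re with hP
  set m0 : ℂ := m - ω * ((((starRingEnd ℂ) ω * m).re : ℝ) : ℂ) with hm0
  have hdec : ∀ z, u z - m0 = ω * (P z + Complex.I * q z) := by
    intro z
    have e1 : ((P z : ℂ) + Complex.I * q z) =
        (starRingEnd ℂ) ω * (u z - m) + ((((starRingEnd ℂ) ω * m).re : ℝ) : ℂ) := by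
      apply Complex.ext
      · simp only [hP, hqdef]
        simp [mul_sub]
      · simp only [hP, hqdef]
        simp
    rw [e1, mul_add, ← mul_assoc, mul_comm ω, conj_mul_self hω, hm0]; ring
  have hPM : ∀ z, |P z| ≤ M := by
    intro z
    refine (Complex.abs_re_le_norm _).trans ?_
    rw [norm_mul, RCLike.norm_conj, hω, one_mul]; exact huM z
  have iu := integrable_bdd_dbar hum huM hX1 hX2
  have idb := integrable_dbar hX1 hX2
  have hJ2 : ∫ z, (starRingEnd ℂ) ωb * ((u z - m0) * dbar X z) = (starRingEnd ℂ) ωb * ∫ z, u z * dbar X z := by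
    rw [integral_const_mul]
    congr 1
    simp_rw [sub_mul]
    rw [integral_sub iu (idb.const_mul m0), integral_const_mul, integral_dbar_zero hX1 hX2]
    simp
  have iJ : Integrable (fun z => (starRingEnd ℂ) ωb * ((u z - m0) * dbar X z)) := by
    have : Integrable (fun z => u z * dbar X z - m0 * dbar X z) := iu.sub (idb.const_mul m0)
    simp_rw [← sub_mul] at this
    exact this.const_mul _
  have hre : ((starRingEnd ℂ) ωb * ∫ z, u z * dbar X z).re =
      ∫ z, ((starRingEnd ℂ) ωb * ((u z - m0) * dbar X z)).re := by
    rw [← hJ2]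
    exact (Complex.reCLM.integral_comp_comm iJ).symm
  have hz0 : ∀ z ∉ ball x (3 * r), dbar X z = 0 := by
    intro z hz
    have hmin : IsLocalMin χ z := Filter.Eventually.of_forall fun w => by
      rw [c2 z hz]; exact c5 w
    have := norm_dbar_coe c1 z
    rw [hmin.fderiv_eq_zero, norm_zero] at this
    exact norm_le_zero_iff.1 this
  have hpt : ∀ z, ‖((starRingEnd ℂ) ωb * ((u z - m0) * dbar X z)).re‖ₑ ≤
      ENNReal.ofReal (M / 2) * ‖fderiv ℝ χ z ((starRingEnd ℂ) γ)‖ₑ +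
      (ball x (3 * r)).indicator (fun z => ENNReal.ofReal (c / (η * r)) * ‖q z‖ₑ) z := by
    intro z
    have e : (starRingEnd ℂ) ωb * ((u z - m0) * dbar X z) =
        (P z : ℝ) * (γ * dbar X z) + (q z : ℝ) * (γ * Complex.I * dbar X z) := by
      rw [hdec, hγ]; ring
    rw [e, Complex.add_re, Complex.re_ofReal_mul, Complex.re_ofReal_mul, re_mul_dbar c1]
    refine (enorm_add_le _ _).trans ?_
    apply add_le_add
    · rw [← mul_assoc, enorm_mul]
      gcongr
      rw [← ofReal_norm, Real.norm_eq_abs]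
      apply ENNReal.ofReal_le_ofReal
      rw [abs_mul, abs_of_pos (by norm_num : (0:ℝ) < 1 / 2)]
      linarith [hPM z]
    · by_cases hz : z ∈ ball x (3 * r)
      · rw [Set.indicator_of_mem hz, enorm_mul, mul_comm]
        gcongr
        rw [← ofReal_norm, Real.norm_eq_abs]
        apply ENNReal.ofReal_le_ofReal
        refine (Complex.abs_re_le_norm _).trans ?_
        have hγ1 : ‖γ‖ = 1 := by rw [← hν, RCLike.norm_conj]
        rw [norm_mul, norm_mul, hγ1, Complex.norm_I, one_mul, one_mul]
        exact (norm_dbar_coe c1 z).trans (c8 z)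
      · rw [hz0 z hz]; simp
  have hqm : Measurable q := by
    have : Measurable (fun z => (starRingEnd ℂ) ω * (u z - m)) := by fun_prop
    exact Complex.measurable_im.comp this
  have hup : ((starRingEnd ℂ) ωb * ∫ z, u z * dbar X z).re ≤
      M / 2 * (2 * ((1 + 2 * η) * r)) + c / (η * r) * (κ * r ^ 2) := by
    refine (le_abs_self _).trans ?_
    rw [hre, ← Real.norm_eq_abs]
    apply (ENNReal.ofReal_le_ofReal_iff (by positivity)).1
    rw [ofReal_norm]
    refine (enorm_integral_le_lintegral_enorm _).trans ?_
    refine (lintegral_mono hpt).trans ?_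
    have hcm : Continuous (fun z => fderiv ℝ χ z ((starRingEnd ℂ) γ)) := by
      have := c1.continuous_fderiv one_ne_zero
      fun_prop
    rw [lintegral_add_left (by fun_prop), lintegral_const_mul' _ _ ENNReal.ofReal_ne_top,
      lintegral_indicator isOpen_ball.measurableSet, lintegral_const_mul' _ _ ENNReal.ofReal_ne_top,
      ENNReal.ofReal_add (by positivity) (by positivity), ENNReal.ofReal_mul (by positivity),
      ENNReal.ofReal_mul (p := c / (η * r)) (by positivity)]
    gcongr
  -- lower bound
  have iχ : Integrable χ μ :=
    c1.continuous.integrable_of_hasCompactSupport c3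
  have hχlow : (1 - ε) * r ≤ ∫ z, χ z ∂μ := by
    apply (ENNReal.ofReal_le_ofReal_iff (integral_nonneg c5)).1
    refine hSμ.trans ?_
    rw [ofReal_integral_eq_lintegral_ofReal iχ (Filter.Eventually.of_forall c5)]
    have := mul_meas_ge_le_lintegral₀ (μ := μ) (f := fun z => ENNReal.ofReal (χ z))
      (by have := c1.continuous.measurable; fun_prop) 1
    rw [one_mul] at this
    refine (measure_mono fun z hz => ?_).trans this
    simp [c7 z hz]
  have ib : Integrable (fun z => X z * (b z - b x)) μ :=
    (hb.sub (integrable_const _)).bdd_mul hX1.continuous.aestronglyMeasurable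
      (c := 1) (Filter.Eventually.of_forall fun z => by
        simp only [hX, Complex.norm_real, Real.norm_eq_abs, abs_of_nonneg (c5 z)]; exact c6 z)
  have hsplit : ∫ z, X z * b z ∂μ = b x * ((∫ z, χ z ∂μ : ℝ) : ℂ) + ∫ z, X z * (b z - b x) ∂μ := by
    rw [← integral_complex_ofReal, ← integral_const_mul, ← integral_add _ ib]
    · congr 1; ext z; simp only [hX]; ring
    · exact (iχ.ofReal).const_mul _
  have herr : ‖∫ z, X z * (b z - b x) ∂μ‖ ≤ τ * (3 * r) := by
    apply (ENNReal.ofReal_le_ofReal_iff (by positivity)).1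
    rw [ofReal_norm]
    refine (enorm_integral_le_lintegral_enorm _).trans (le_trans ?_ hbl)
    rw [← lintegral_indicator isClosed_closedBall.measurableSet]
    refine lintegral_mono fun z => ?_
    by_cases hz : z ∈ closedBall x (3 * r)
    · rw [Set.indicator_of_mem hz, enorm_mul]
      refine mul_le_of_le_one_left (by simp) ?_
      rw [← ofReal_norm]
      simp only [hX, Complex.norm_real, Real.norm_eq_abs, abs_of_nonneg (c5 z)]
      simpa using c6 z
    · have : χ z = 0 := c2 z fun h => hz (ball_subset_closedBall h)
      simp [hX, this]
  have hlow : ‖b x‖ * ((1 - ε) * r) - τ * (3 * r) ≤ ((starRingEnd ℂ) ωb * ∫ z, u z * dbar X z).re := by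
    rw [hJ, hsplit, mul_add, Complex.add_re]
    have e1 : (starRingEnd ℂ) ωb * (b x * ((∫ z, χ z ∂μ : ℝ) : ℂ)) = ((‖b x‖ * ∫ z, χ z ∂μ : ℝ) : ℂ) := by
      conv_lhs => rw [hβ]
      push_cast
      calc _ = ((starRingEnd ℂ) ωb * ωb) * (‖b x‖ * ((∫ z, χ z ∂μ : ℝ) : ℂ)) := by ring
        _ = _ := by rw [conj_mul_self hωb, one_mul]
    rw [e1, Complex.ofReal_re]
    have e2 := Complex.abs_re_le_norm ((starRingEnd ℂ) ωb * ∫ z, X z * (b z - b x) ∂μ)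
    rw [norm_mul, RCLike.norm_conj, hωb, one_mul] at e2
    have e3 := (abs_le.1 (e2.trans herr)).1
    have e4 := mul_le_mul_of_nonneg_left hχlow (norm_nonneg (b x))
    linarith
  have hfin := hlow.trans hup
  have e5 : c / (η * r) * (κ * r ^ 2) = c * κ / η * r := by field_simp
  rw [e5] at hfin
  apply le_of_mul_le_mul_right _ hr
  nlinarith

lemma density_bound {μ : Measure ℂ} [IsFiniteMeasure μ] {u b b2 : ℂ → ℂ} {U : Set ℂ} {M : ℝ} {x : ℂ}
    (hU : IsOpen U) (hx : x ∈ U) (hum : Measurable u) (huM : ∀ z, ‖u z‖ ≤ M)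
    (hb : Integrable b μ) (hb2 : Integrable b2 μ)
    (ht : ∀ χ, Test U χ → ∫ z, u z * dbar χ z = ∫ z, χ z * b z ∂μ)
    (ht2 : ∀ χ, Test U χ → ∫ z, u z ^ 2 * dbar χ z = ∫ z, χ z * b2 z ∂μ)
    (hl : ∀ τ > 0, ∃ r0 > 0, ∀ r, 0 < r → r < r0 →
      ∫⁻ y in closedBall x r, ‖b y - b x‖ₑ ∂μ ≤ ENNReal.ofReal (τ * r))
    (hl2 : ∀ τ > 0, ∃ r0 > 0, ∀ r, 0 < r → r < r0 →
      ∫⁻ y in closedBall x r, ‖b2 y - b2 x‖ₑ ∂μ ≤ ENNReal.ofReal (τ * r))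
    (hd : ∀ ε > 0, ∀ δ > 0, ∃ C : Set ℂ, x ∈ C ∧ 0 < diam C ∧ diam C ≤ δ ∧ Bornology.IsBounded C ∧
      ENNReal.ofReal ((1 - ε) * diam C) ≤ μ C) : ‖b x‖ ≤ M := by
  have hM0 : 0 ≤ M := (norm_nonneg _).trans (huM 0)
  by_cases hbx : b x = 0
  · rw [hbx, norm_zero]; exact hM0
  obtain ⟨c, hc, hstep⟩ := step_bound
  obtain ⟨R, hR, hRU⟩ := nhds_basis_closedBall.mem_iff.1 (hU.mem_nhds hx)
  have key : ∀ t : ℝ, 0 < t → t ≤ 1 → ‖b x‖ * (1 - t) ≤ M * (1 + 2 * t) + c * t + 3 * t := by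
    intro t ht0 ht1
    obtain ⟨r1, hr1, h1⟩ := near_line hR hRU hum huM hb hb2 ht ht2 hl hl2 hbx (κ := t ^ 2) (by positivity)
    obtain ⟨r0, hr0, h0⟩ := hl t ht0
    obtain ⟨C, d1, d2, d3, d4, d5⟩ := hd t ht0 (min r1 (min r0 R) / 4) (by positivity)
    have d6 : 4 * diam C ≤ min r1 (min r0 R) := by linarith
    rw [le_min_iff, le_min_iff] at d6
    obtain ⟨ω, m, hω, hq⟩ := h1 (diam C) d2 (by linarith)
    have := hstep hum huM hb ht ((closedBall_subset_closedBall (by linarith)).trans hRU) hω d2 ht0 ht1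
      (by positivity) ht0 hq d1 d4 rfl d5 (h0 _ (by positivity) (by linarith))
    have e : c * t ^ 2 / t = c * t := by field_simp
    rwa [e] at this
  by_contra hcon
  push Not at hcon
  set D := ‖b x‖ + 2 * M + c + 3 with hD
  have hD0 : 0 < D := by positivity
  have h1 := key (min 1 ((‖b x‖ - M) / (2 * D))) (lt_min one_pos (by
    apply div_pos <;> linarith)) (min_le_left _ _)
  set t := min 1 ((‖b x‖ - M) / (2 * D))
  have h2 : t ≤ (‖b x‖ - M) / (2 * D) := min_le_right _ _
  rw [le_div_iff₀ (by positivity)] at h2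
  nlinarith

theorem thmX {E U : Set ℂ} {u : ℂ → ℂ} {M : ℝ} (hE : IsCompact E) (hfin : μH[1] E ≠ ∞)
    (hU : IsOpen U) (hum : Measurable u) (huM : ∀ z, ‖u z‖ ≤ M)
    (hud : DifferentiableOn ℂ u (U \ E)) {χ : ℂ → ℂ} (hχ : Test U χ) {D : ℝ} (hD : ∀ z ∈ E, ‖χ z‖ ≤ D) :
    ‖∫ z, u z * dbar χ z‖ ≤ M * D * (μH[1] E).toReal := by
  have hM0 : 0 ≤ M := (norm_nonneg _).trans (huM 0)
  have : Fact (μH[1] E < ∞) := ⟨hfin.lt_top⟩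
  obtain ⟨b, hb, ht⟩ := exists_density hE hfin hU hum huM hud
  obtain ⟨b2, hb2, ht2⟩ := exists_density (u := fun z => u z ^ 2) (M := M ^ 2) hE hfin hU (by fun_prop)
    (fun z => by rw [norm_pow]; have := huM z; gcongr) (hud.pow 2)
  rw [ht χ hχ]
  have hae : ∀ᵐ x ∂((μH[1]).restrict E), ‖χ x * b x‖ ≤ M * D := by
    filter_upwards [ae_lebesgue hE hfin hb, ae_lebesgue hE hfin hb2, ae_lower_density hE hfin,
      ae_restrict_mem hE.measurableSet] with x h1 h2 h3 h4
    have hDx := hD x h4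
    by_cases hx : x ∈ U
    · have := density_bound hU hx hum huM hb hb2 ht ht2 h1 h2 h3
      rw [norm_mul, mul_comm]
      gcongr
    · have h0 : χ x = 0 := by
        by_contra h
        exact hx (hχ.2.2 (subset_tsupport _ h))
      rw [h0, norm_zero] at hDx
      rw [h0, zero_mul, norm_zero]
      positivity
  have h := norm_integral_le_of_norm_le_const hae
  simpa [Measure.real] using h

end Cell


namespace Cell
open scoped ENNReal

lemma exists_eta {E K : Set ℂ} (hE : IsCompact E) (hK : IsClosed K) (hd : Disjoint E K) :
    ∃ η : ℂ → ℂ, ContDiff ℝ 1 η ∧ HasCompactSupport η ∧ tsupport η ⊆ Kᶜ ∧ ∀ᶠ z in nhdsSet E, η z = 1 := by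
  obtain ⟨V, hV1, hV2, hV3⟩ := exists_open_between_and_isCompact_closure hE hK.isOpen_compl
    (Set.disjoint_left.1 hd)
  obtain ⟨f, f1, f2, f3⟩ := exists_contMDiffMap_one_nhds_of_subset_interior (modelWithCornersSelf ℝ ℂ) (n := ⊤)
    hE.isClosed (t := V) (by rwa [hV1.interior_eq])
  have hs : tsupport (fun z => ((f z : ℝ) : ℂ)) ⊆ closure V := by
    apply closure_mono
    intro z hz
    by_contra h
    apply hz
    simp [f2 z h]
  refine ⟨fun z => ((f z : ℝ) : ℂ), ?_, ?_, hs.trans hV3.1, ?_⟩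
  · have : ContDiff ℝ 1 f := (f.contMDiff.contDiff).of_le (by simp)
    exact Complex.ofRealCLM.contDiff.comp this
  · exact hV3.2.of_isClosed_subset (isClosed_tsupport _) hs
  · filter_upwards [f1] with z hz
    simp [hz]

lemma cauchy_infty {F : ℂ → ℂ} {A : ℂ} {δ0 : ℝ} (hF : ContDiff ℝ 1 F) (hδ0 : 0 < δ0)
    (hA : ∀ z ∈ closedBall A δ0, dbar F z = 0) (hc : HasCompactSupport (dbar F))
    (h0 : Filter.Tendsto F (Bornology.cobounded ℂ) (nhds 0)) :
    ∫ z, dbar F z * (z - A)⁻¹ = - (π * F A) := by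
  obtain ⟨C, hC, hcut⟩ := exists_cutoff
  have main : ∀ ε > 0, ‖(∫ z, dbar F z * (z - A)⁻¹) + π * F A‖ ≤ ε * (π + 4 * π * C) := by
    intro ε hε
    obtain ⟨δ1, hδ1, hcl⟩ := Metric.continuousAt_iff.1 (hF.continuous.continuousAt (x := A)) ε hε
    -- radius
    have h1 : ∀ᶠ z in Bornology.cobounded ℂ, ‖F z‖ < ε := by
      have := h0.norm
      rw [norm_zero] at this
      exact this.eventually_lt_const hε
    obtain ⟨R1, -, hR1⟩ := (Metric.hasBasis_cobounded_compl_closedBall A).eventually_iff.1 h1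
    obtain ⟨R2, hR2⟩ := hc.isBounded.subset_closedBall A
    set R : ℝ := max (max (R1 + 1) R2) (δ0 + 1) with hR
    have hRa : R1 + 1 ≤ R := (le_max_left _ _).trans (le_max_left _ _)
    have hRb : R2 ≤ R := (le_max_right _ _).trans (le_max_left _ _)
    have hRc : δ0 + 1 ≤ R := le_max_right _ _
    have hR0 : 0 < R := by linarith
    obtain ⟨θ, t1, t2, t3, t4, t5, t6⟩ := hcut A R hR0
    have hθc : HasCompactSupport θ := (isCompact_closedBall A _).of_isClosed_subset (isClosed_tsupport _) t3
    set δ : ℝ := min (δ1 / 2) δ0 with hδ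
    have hδp : 0 < δ := by positivity
    set G : ℂ → ℂ := fun z => F z * θ z with hG
    have hG1 : ContDiff ℝ 1 G := hF.mul t1
    have hGc : HasCompactSupport G := hθc.mul_left
    have hθ0 : ∀ z ∈ ball A R, dbar θ z = 0 := by
      intro z hz
      have : θ =ᶠ[nhds z] fun _ => 1 := by
        filter_upwards [isOpen_ball.mem_nhds hz] with w hw
        exact t2 w (ball_subset_closedBall hw)
      rw [dbar_congr this]; simp [dbar]
    have hdG : ∀ z, dbar G z = dbar F z + F z * dbar θ z := by
      intro z
      rw [hG, dbar_mul (hF.differentiable one_ne_zero z) (t1.differentiable one_ne_zero z), add_comm]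
      congr 1
      by_cases hz : z ∈ closedBall A R
      · rw [t2 z hz, one_mul]
      · have : dbar F z = 0 := by
          by_contra h
          exact hz (closedBall_subset_closedBall hRb (hR2 (subset_tsupport _ h)))
        rw [this, mul_zero]
    set k : ℂ → ℂ := fun z => kK δ (z - A) with hk
    have hk1 : ContDiff ℝ 1 k := (contDiff_kK hδp).comp (contDiff_id.sub contDiff_const)
    have hdk : ∀ z, dbar k z = kP δ (z - A) := by
      intro z
      rw [← dbar_kK hδp (z - A)]
      simp only [dbar, hk, sub_eq_add_neg]
      rw [fderiv_comp_add_right]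
    have hzero : ∫ z, dbar (fun w => G w * k w) z = 0 :=
      integral_dbar_zero (hG1.mul hk1) hGc.mul_right
    have hkG : ∀ z, k z * dbar G z = dbar F z * (z - A)⁻¹ + F z * dbar θ z * (z - A)⁻¹ := by
      intro z
      rw [← add_mul, ← hdG, mul_comm]
      by_cases hz : z ∈ closedBall A δ0
      · have hzR : z ∈ ball A R := by
          rw [mem_closedBall] at hz; rw [mem_ball]; linarith
        rw [hdG, hA z hz, hθ0 z hzR]; simp
      · congr 1
        apply kK_eq hδp
        rw [mem_closedBall, dist_eq_norm, not_le] at hz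
        exact (min_le_right _ _).trans hz.le
    have hpt : ∀ z, dbar (fun w => G w * k w) z =
        G z * kP δ (z - A) + (dbar F z * (z - A)⁻¹ + F z * dbar θ z * (z - A)⁻¹) := by
      intro z
      rw [dbar_mul (hG1.differentiable one_ne_zero z) (hk1.differentiable one_ne_zero z), hdk, hkG]
    have hbd : ∀ z, z ∉ ball A δ0 → ‖(z - A)⁻¹‖ ≤ δ0⁻¹ := by
      intro z hz
      rw [mem_ball, dist_eq_norm, not_lt] at hz
      rw [norm_inv]
      gcongr
    -- integrability
    obtain ⟨BG, hBG⟩ := hG1.continuous.bounded_above_of_compact_support hGc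
    have i1 : Integrable (fun z => G z * kP δ (z - A)) :=
      (kP_integrable hδp A).bdd_mul hG1.continuous.aestronglyMeasurable (Filter.Eventually.of_forall hBG)
    have hkb : ∀ z, z ∉ ball A δ0 → k z = (z - A)⁻¹ := by
      intro z hz
      rw [mem_ball, dist_eq_norm, not_lt] at hz
      exact kK_eq hδp ((min_le_right _ _).trans hz)
    have ek : ∀ f : ℂ → ℂ, (∀ z ∈ ball A δ0, f z = 0) → (fun z => f z * (z - A)⁻¹) = fun z => f z * k z := by
      intro f hf
      ext z
      by_cases hz : z ∈ ball A δ0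
      · rw [hf z hz]; simp
      · rw [hkb z hz]
    have hFb0 : ∀ z ∈ ball A δ0, dbar F z = 0 := fun z hz => hA z (ball_subset_closedBall hz)
    have hTb0 : ∀ z ∈ ball A δ0, F z * dbar θ z = 0 := fun z hz => by
      rw [hθ0 z (ball_subset_ball (by linarith) hz), mul_zero]
    have i2 : Integrable (fun z => dbar F z * (z - A)⁻¹) := by
      rw [ek _ hFb0]
      exact ((continuous_dbar hF).mul hk1.continuous).integrable_of_hasCompactSupport hc.mul_right
    have i3 : Integrable (fun z => F z * dbar θ z * (z - A)⁻¹) := by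
      rw [ek _ hTb0]
      exact ((hF.continuous.mul (continuous_dbar t1)).mul hk1.continuous).integrable_of_hasCompactSupport
        (HasCompactSupport.mul_right (HasCompactSupport.mul_left (compact_dbar hθc)))
    have hsum : (∫ z, G z * kP δ (z - A)) + ((∫ z, dbar F z * (z - A)⁻¹) +
        ∫ z, F z * dbar θ z * (z - A)⁻¹) = 0 := by
      have i23 : Integrable (fun z => dbar F z * (z - A)⁻¹ + F z * dbar θ z * (z - A)⁻¹) := i2.add i3
      rw [← integral_add i2 i3, ← integral_add i1 i23, ← hzero]
      congr 1; ext z; rw [hpt]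
    have hGA : G A = F A := by
      rw [hG]; beta_reduce; rw [t2 A (mem_closedBall_self hR0.le), mul_one]
    have e1 : ‖(∫ z, G z * kP δ (z - A)) - π * F A‖ ≤ ε * π := by
      rw [← hGA]
      apply kP_close hδp hG1.continuous.measurable hBG
      intro w hw
      rw [mem_closedBall] at hw
      have hwδ1 : dist w A < δ1 := by
        have := min_le_left (δ1 / 2) δ0
        linarith
      have hwR : w ∈ closedBall A R := by
        have := min_le_right (δ1 / 2) δ0
        rw [mem_closedBall]; linarith
      rw [hGA, hG]; beta_reduce
      rw [t2 w hwR, mul_one, ← dist_eq_norm]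
      exact (hcl hwδ1).le
    have e2 : ‖∫ z, F z * dbar θ z * (z - A)⁻¹‖ ≤ ε * (4 * π * C) := by
      apply (ENNReal.ofReal_le_ofReal_iff (by positivity)).1
      rw [ofReal_norm]
      refine (enorm_integral_le_lintegral_enorm _).trans ?_
      have := lintegral_le_of_support (f := fun z => ‖F z * dbar θ z * (z - A)⁻¹‖ₑ) (x := A) (s := 2 * R)
        (c := ε * (C / R) * R⁻¹) (by positivity) (by positivity) (by
          intro z hz
          have : dbar θ z = 0 := dbar_zero_of fun h => hz (t3 h)
          simp [this]) (by
          intro z _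
          rw [← ofReal_norm]
          apply ENNReal.ofReal_le_ofReal
          by_cases hz : z ∈ ball A R
          · rw [hθ0 z hz]; simp; positivity
          · have hz' := hz
            rw [mem_ball, dist_eq_norm, not_lt] at hz
            rw [norm_mul, norm_mul, norm_inv]
            have g1 : ‖dbar θ z‖ ≤ C / R := (norm_dbar_le _ _).trans (t6 z)
            have g2 : ‖F z‖ ≤ ε := by
              refine (hR1 fun hz1 => ?_).le
              rw [mem_closedBall, dist_eq_norm] at hz1
              linarith
            gcongr)
      refine this.trans (ENNReal.ofReal_le_ofReal (le_of_eq ?_))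
      field_simp
      ring
    have e3 : (∫ z, dbar F z * (z - A)⁻¹) + π * F A =
        -((∫ z, G z * kP δ (z - A)) - π * F A) - ∫ z, F z * dbar θ z * (z - A)⁻¹ := by
      linear_combination hsum
    rw [e3]
    refine (norm_sub_le _ _).trans ?_
    rw [norm_neg]
    linarith
  have hz : ‖(∫ z, dbar F z * (z - A)⁻¹) + π * F A‖ ≤ 0 := by
    apply le_of_forall_pos_le_add
    intro ε hε
    have := main (ε / (π + 4 * π * C)) (by positivity)
    rw [div_mul_cancel₀ _ (by positivity)] at this
    linarith
  exact eq_neg_of_add_eq_zero_left (norm_le_zero_iff.1 hz)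

end Cell


namespace Cell
open scoped ENNReal

lemma integrable_cauchy {f : ℂ → ℂ} {A : ℂ} {δ0 : ℝ} (hf : Continuous f) (hδ0 : 0 < δ0)
    (hA : ∀ z ∈ closedBall A δ0, f z = 0) (hc : HasCompactSupport f) :
    Integrable (fun z => f z * (z - A)⁻¹) := by
  have e : (fun z => f z * (z - A)⁻¹) = fun z => f z * kK δ0 (z - A) := by
    ext z
    by_cases hz : z ∈ closedBall A δ0
    · rw [hA z hz]; simp
    · rw [mem_closedBall, dist_eq_norm, not_le] at hz
      rw [kK_eq hδ0 hz.le]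
  rw [e]
  have hk : Continuous (fun z => kK δ0 (z - A)) :=
    (contDiff_kK hδ0).continuous.comp (continuous_id.sub continuous_const)
  exact (hf.mul hk).integrable_of_hasCompactSupport hc.mul_right

lemma key_ineq {g K : Set ℂ} {A : ℂ} {φ h : ℂ → ℂ} {M : ℝ} (hM0 : 0 ≤ M)
    (hg : IsOpen g) (hgb : Bornology.IsBounded g)
    (hK : IsCompact K) (hKg : K ⊆ g) (hAK : A ∈ K)
    (hd : 0 < infDist A (frontier g)) (hfin : μH[1] (frontier g) ≠ ∞)
    (hφ : DifferentiableOn ℂ φ Kᶜ)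
    (hφinf : Filter.Tendsto φ (Bornology.cobounded ℂ) (nhds 0))
    (hh : DifferentiableOn ℂ h g)
    (hM : ∀ z ∈ g \ K, ‖φ z - h z‖ ≤ M) :
    π * (‖h A‖ + M) ≤ M * (infDist A (frontier g))⁻¹ * (μH[1] (frontier g)).toReal := by
  classical
  set E := frontier g with hEdef
  have hE : IsCompact E := Metric.isCompact_of_isClosed_isBounded isClosed_frontier
    (hgb.closure.subset frontier_subset_closure)
  have hEg : Disjoint E g := by
    rw [Set.disjoint_left]
    intro z hz hz'
    rw [hEdef, hg.frontier_eq] at hz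
    exact hz.2 hz'
  have hEK : Disjoint E K := hEg.mono_right hKg
  have hKo : IsOpen Kᶜ := hK.isClosed.isOpen_compl
  have hcases : ∀ z, z ∉ E → z ∈ g ∨ z ∈ (closure g)ᶜ := by
    intro z hz
    by_cases h1 : z ∈ g
    · exact Or.inl h1
    · right
      intro h2
      apply hz
      rw [hEdef, hg.frontier_eq]
      exact ⟨h2, h1⟩
  have hco : IsOpen (closure g)ᶜ := isClosed_closure.isOpen_compl
  have hcK : (closure g)ᶜ ⊆ Kᶜ := Set.compl_subset_compl.2 (hKg.trans subset_closure)
  have hcg : ∀ z ∈ (closure g)ᶜ, z ∉ g := fun z hz hz' => hz (subset_closure hz')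
  obtain ⟨ω, hω, hhω⟩ := exists_phase (h A)
  set κ : ℂ := M * ω with hκ
  have hκn : ‖κ‖ = M := by rw [hκ, norm_mul, hω, mul_one, Complex.norm_real, Real.norm_of_nonneg hM0]
  have hhκ : ‖h A + κ‖ = ‖h A‖ + M := by
    have : h A + κ = ((‖h A‖ + M : ℝ) : ℂ) * ω := by
      conv_lhs => rw [hhω]
      rw [hκ]; push_cast; ring
    rw [this, norm_mul, hω, mul_one, Complex.norm_real, Real.norm_of_nonneg (by positivity)]
  -- the bounded function
  set u : ℂ → ℂ := (g \ K).piecewise (fun z => φ z - h z) (((closure g)ᶜ).piecewise (fun _ => κ) fun _ => 0)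
    with hu
  have hgK : IsOpen (g \ K) := hg.sdiff hK.isClosed
  have hφh : DifferentiableOn ℂ (fun z => φ z - h z) (g \ K) :=
    (hφ.mono fun z hz => hz.2).sub (hh.mono fun z hz => hz.1)
  have hu1 : ∀ z ∈ g \ K, u z = φ z - h z := fun z hz => Set.piecewise_eq_of_mem _ _ _ hz
  have hu2 : ∀ z ∈ (closure g)ᶜ, u z = κ := fun z hz => by
    rw [hu, Set.piecewise_eq_of_notMem _ _ _ fun h => hcg z hz h.1, Set.piecewise_eq_of_mem _ _ _ hz]
  have hum : Measurable u := by
    have m1 : Measurable ((g \ K).piecewise (fun z => φ z - h z) fun _ => 0) :=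
      hφh.continuousOn.measurable_piecewise continuousOn_const hgK.measurableSet
    have m2 : Measurable (((closure g)ᶜ).piecewise (fun _ => κ) fun _ => (0:ℂ)) :=
      measurable_const.piecewise hco.measurableSet measurable_const
    have : u = (g \ K).piecewise ((g \ K).piecewise (fun z => φ z - h z) fun _ => 0)
        (((closure g)ᶜ).piecewise (fun _ => κ) fun _ => (0:ℂ)) := by
      ext z
      by_cases hz : z ∈ g \ K <;> simp [hu, hz, Set.piecewise]
    rw [this]
    exact m1.piecewise hgK.measurableSet m2
  have huM : ∀ z, ‖u z‖ ≤ M := by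
    intro z
    by_cases h1 : z ∈ g \ K
    · rw [hu1 z h1]; exact hM z h1
    · by_cases h2 : z ∈ (closure g)ᶜ
      · rw [hu2 z h2, hκn]
      · rw [hu, Set.piecewise_eq_of_notMem _ _ _ h1, Set.piecewise_eq_of_notMem _ _ _ h2]
        simpa using hM0
  have hud : DifferentiableOn ℂ u (Kᶜ \ E) := by
    intro z hz
    apply DifferentiableAt.differentiableWithinAt
    rcases hcases z hz.2 with h1 | h1
    · have h2 : z ∈ g \ K := ⟨h1, hz.1⟩
      refine (hφh.differentiableAt (hgK.mem_nhds h2)).congr_of_eventuallyEq ?_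
      filter_upwards [hgK.mem_nhds h2] with w hw using hu1 w hw
    · refine (differentiableAt_const κ).congr_of_eventuallyEq ?_
      filter_upwards [hco.mem_nhds h1] with w hw using hu2 w hw
  -- cutoff
  obtain ⟨η, η1, η2, η3, η4⟩ := exists_eta hE hK.isClosed hEK
  have hηT : Test Kᶜ η := ⟨η1, η2, η3⟩
  have hAη : A ∉ tsupport η := fun h => η3 h hAK
  have hηE : ∀ z ∈ E, ∀ᶠ w in nhds z, η w = 1 := fun z hz => by
    exact (eventually_nhdsSet_iff_forall.1 η4) z hz
  have hηE0 : ∀ z ∈ E, dbar η z = 0 := by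
    intro z hz
    have : η =ᶠ[nhds z] fun _ => 1 := hηE z hz
    rw [dbar_congr this]; simp [dbar]
  have hinv : DifferentiableOn ℂ (fun z => (z - A)⁻¹) Kᶜ := by
    intro z hz
    have : z - A ≠ 0 := fun h => hz (by rw [sub_eq_zero.1 h]; exact hAK)
    exact ((differentiableAt_id.sub_const A).inv this).differentiableWithinAt
  set χ : ℂ → ℂ := fun z => (z - A)⁻¹ * η z with hχ
  have hχs : tsupport χ ⊆ tsupport η := tsupport_mul_subset_right
  have hχT : Test Kᶜ χ := ⟨test_mul_holo hKo hinv hηT, η2.mul_left, hχs.trans η3⟩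
  have hdχ : ∀ z, dbar χ z = (z - A)⁻¹ * dbar η z := by
    intro z
    by_cases hz : z ∈ tsupport η
    · have hd1 := hinv.differentiableAt (hKo.mem_nhds (η3 hz))
      rw [hχ, dbar_mul (hd1.restrictScalars ℝ) (η1.differentiable one_ne_zero z), dbar_holo hd1]
      simp
    · rw [dbar_zero_of hz, dbar_zero_of fun h => hz (hχs h), mul_zero]
  -- the function W
  set W : ℂ → ℂ := g.piecewise (fun z => h z + κ) φ with hW
  have hWan : ∀ z, z ∉ E → AnalyticAt ℂ W z := by
    intro z hz
    rcases hcases z hz with h1 | h1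
    · refine ((hh.analyticAt (hg.mem_nhds h1)).add (analyticAt_const (v := κ))).congr ?_
      filter_upwards [hg.mem_nhds h1] with w hw
      rw [hW, Set.piecewise_eq_of_mem _ _ _ hw]; rfl
    · refine ((hφ.mono hcK).analyticAt (hco.mem_nhds h1)).congr ?_
      filter_upwards [hco.mem_nhds h1] with w hw
      rw [hW, Set.piecewise_eq_of_notMem _ _ _ (hcg w hw)]
  set F : ℂ → ℂ := fun z => (1 - η z) * W z with hF
  have hFE : ∀ z ∈ E, F =ᶠ[nhds z] fun _ => 0 := by
    intro z hz
    filter_upwards [hηE z hz] with w hw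
    simp [hF, hw]
  have hF1 : ContDiff ℝ 1 F := by
    rw [contDiff_iff_contDiffAt]
    intro z
    by_cases hz : z ∈ E
    · exact contDiffAt_const.congr_of_eventuallyEq (hFE z hz)
    · have w1 : ContDiffAt ℝ 1 W z := ((hWan z hz).contDiffAt (n := 1)).restrict_scalars ℝ
      exact (contDiffAt_const.sub η1.contDiffAt).mul w1
  have hdF : ∀ z, dbar F z = - (W z * dbar η z) := by
    intro z
    by_cases hz : z ∈ E
    · rw [dbar_congr (hFE z hz), hηE0 z hz]; simp [dbar]
    · have d1 : DifferentiableAt ℝ (fun z => 1 - η z) z :=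
        (differentiableAt_const _).sub (η1.differentiable one_ne_zero z)
      have d2 := (hWan z hz).differentiableAt
      rw [hF, dbar_mul d1 (d2.restrictScalars ℝ), dbar_holo d2]
      have : dbar (fun z => 1 - η z) z = - dbar η z := by
        unfold dbar
        rw [fderiv_const_sub]
        simp; ring
      rw [this]; ring
  have hFc : HasCompactSupport (dbar F) := by
    refine HasCompactSupport.intro η2 fun z hz => ?_
    rw [hdF, dbar_zero_of hz]; simp
  obtain ⟨δ0, hδ0, hball⟩ := nhds_basis_closedBall.mem_iff.1
    ((isClosed_tsupport η).isOpen_compl.mem_nhds hAη)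
  have hFA0 : ∀ z ∈ closedBall A δ0, dbar F z = 0 := by
    intro z hz
    rw [hdF, dbar_zero_of (hball hz)]; simp
  have hFA : F A = h A + κ := by
    have : η A = 0 := image_eq_zero_of_notMem_tsupport hAη
    simp only [hF, hW, this, Set.piecewise_eq_of_mem _ _ _ (hKg hAK)]
    ring
  have hFinf : Filter.Tendsto F (Bornology.cobounded ℂ) (nhds 0) := by
    refine hφinf.congr' ?_
    have b1 : gᶜ ∈ Bornology.cobounded ℂ := Bornology.isBounded_def.1 hgb
    have b2 : (tsupport η)ᶜ ∈ Bornology.cobounded ℂ := Bornology.isBounded_def.1 η2.isBounded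
    filter_upwards [b1, b2] with z h1 h2
    simp only [hF, hW, image_eq_zero_of_notMem_tsupport h2, Set.piecewise_eq_of_notMem _ _ _ h1]
    ring
  have hcau := cauchy_infty hF1 hδ0 hFA0 hFc hFinf
  have hintA := integrable_cauchy (continuous_dbar hF1) hδ0 hFA0 hFc
  have hintB := integrable_bdd_dbar hum huM hχT.1 hχT.2.1
  have hpt : ∀ z, (φ z + κ) * dbar χ z = u z * dbar χ z - dbar F z * (z - A)⁻¹ := by
    intro z
    rw [hdχ, hdF]
    by_cases h0 : dbar η z = 0
    · rw [h0]; ring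
    · have hzE : z ∉ E := fun h => h0 (hηE0 z h)
      have hzK : z ∉ K := fun h => h0 (dbar_zero_of fun h' => η3 h' h)
      rcases hcases z hzE with h1 | h1
      · rw [hu1 z ⟨h1, hzK⟩, hW, Set.piecewise_eq_of_mem _ _ _ h1]; ring
      · rw [hu2 z h1, hW, Set.piecewise_eq_of_notMem _ _ _ (hcg z h1)]; ring
  have hz := integral_holo_dbar hKo (hφ.add (differentiableOn_const κ)) hχT
  have hz' : ∫ z, (φ z + κ) * dbar χ z = 0 := hz
  simp_rw [hpt] at hz'
  rw [integral_sub hintB hintA, hcau, hFA, sub_neg_eq_add] at hz'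
  have hbound := thmX hE hfin hKo hum huM hud hχT (D := (infDist A E)⁻¹) (by
    intro z hz
    have : η z = 1 := (hηE z hz).self_of_nhds
    rw [hχ]; beta_reduce
    rw [this, mul_one, norm_inv]
    gcongr
    rw [← dist_eq_norm, dist_comm]
    exact infDist_le_dist_of_mem hz)
  rw [eq_neg_of_add_eq_zero_left hz', norm_neg, norm_mul, Complex.norm_real, Real.norm_of_nonneg pi_pos.le,
    hhκ] at hbound
  exact hbound

end Cell

theorem stmt_1 (g : Set ℂ) (A : ℂ) (K : Set ℂ) (φ h : ℂ → ℂ) (ρ M : ℝ)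
    (hg : IsOpen g) (hgb : Bornology.IsBounded g)
    (hK : IsCompact K) (hKg : K ⊆ g) (hAK : A ∈ K)
    (hρ : ρ = 2 * π * infDist A (frontier g) / (μH[1] (frontier g)).toReal)
    (hρpos : 0 < ρ)
    (hφ : DifferentiableOn ℂ φ Kᶜ)
    (hφinf : Filter.Tendsto φ (Bornology.cobounded ℂ) (nhds 0))
    (hh : DifferentiableOn ℂ h g) (hhb : ∃ C, ∀ z ∈ g, ‖h z‖ ≤ C)
    (hM : ∀ z ∈ g \ K, ‖φ z - h z‖ ≤ M) :
    ρ / 2 * Filter.limsup (fun z => ‖φ z‖) (nhdsWithin A Kᶜ) ≤ M := by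
  have hd : 0 < infDist A (frontier g) := by
    refine lt_of_le_of_ne infDist_nonneg fun h0 => ?_
    rw [hρ, ← h0] at hρpos
    simp at hρpos
  have hL : 0 < (μH[1] (frontier g)).toReal := by
    refine lt_of_le_of_ne ENNReal.toReal_nonneg fun h0 => ?_
    rw [hρ, ← h0] at hρpos
    simp at hρpos
  have hfin : μH[1] (frontier g) ≠ ⊤ := fun h0 => by
    rw [h0] at hL; simp at hL
  have hne : (g \ K).Nonempty := by
    by_contra hcon
    rw [Set.not_nonempty_iff_eq_empty, Set.sdiff_eq_empty] at hcon
    have hgK : g = K := hcon.antisymm hKg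
    have hcl : IsClopen g := ⟨hgK ▸ hK.isClosed, hg⟩
    rw [hcl.frontier_eq] at hd
    simp at hd
  have hM0 : 0 ≤ M := by
    obtain ⟨z, hz⟩ := hne
    exact (norm_nonneg _).trans (hM z hz)
  have key := Cell.key_ineq hM0 hg hgb hK hKg hAK hd hfin hφ hφinf hh hM
  set d := infDist A (frontier g)
  set L := (μH[1] (frontier g)).toReal
  have hlim : Filter.limsup (fun z => ‖φ z‖) (nhdsWithin A Kᶜ) ≤ ‖h A‖ + M := by
    rcases (nhdsWithin A Kᶜ).eq_or_neBot with hbot | hnb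
    · rw [hbot]
      have : Filter.limsup (fun z => ‖φ z‖) (⊥ : Filter ℂ) = 0 := by
        simp [Filter.limsup, Filter.limsSup]
      rw [this]; positivity
    · apply le_of_forall_pos_le_add
      intro ε hε
      refine Filter.limsup_le_of_le
        (Filter.isCoboundedUnder_le_of_le _ (x := 0) fun z => norm_nonneg _) ?_
      have hc : ContinuousAt h A := (hh.differentiableAt (hg.mem_nhds (hKg hAK))).continuousAt
      have h1 : ∀ᶠ z in nhds A, ‖h z‖ < ‖h A‖ + ε := hc.norm.eventually_lt_const (by linarith)
      filter_upwards [nhdsWithin_le_nhds h1, nhdsWithin_le_nhds (hg.mem_nhds (hKg hAK)),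
        self_mem_nhdsWithin] with z hz1 hz2 hz3
      have h2 := hM z ⟨hz2, hz3⟩
      have h3 := norm_sub_norm_le (φ z) (h z)
      linarith
  have hρ2 : ρ / 2 = π * d / L := by rw [hρ]; ring
  rw [hρ2]
  calc π * d / L * _ ≤ π * d / L * (‖h A‖ + M) := by gcongr
    _ = d / L * (π * (‖h A‖ + M)) := by ring
    _ ≤ d / L * (M * d⁻¹ * L) := by gcongr
    _ = M := by field_simp
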